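/- arXiv:1208.1509 — 3 statements merged into one kernel-verified Lean document; each statement's English description precedes it below -/
import Mathlib

section
/- Let μ ≤C ν be probability measures on ℝ with finite first moments, let h : ℝ → ℝ be differentiable with strictly convex derivative h', and let c(x,y) = h(y−x) satisfy the sufficient integrability condition with respect to μ and ν. Assume the infimum of ∫ c dπ over π ∈ Π_M(μ,ν) is finite. Then there exists exactly one optimal π ∈ Π_M(μ,ν) for c, and this optimizer is left-monotone (it is the left-curtain coupling). -/
open MeasureTheory Set Filter Topology

noncomputable section

/-- Convex order of finite measures on `ℝ` with finite first moments. -/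
def ConvexOrder (μ ν : MeasureTheory.Measure ℝ) : Prop :=
  μ Set.univ = ν Set.univ ∧
  (∫ x, x ∂μ) = (∫ x, x ∂ν) ∧
  ∀ k : ℝ, (∫ x, max (x - k) 0 ∂μ) ≤ ∫ x, max (x - k) 0 ∂ν

/-- Extended convex order: integrals of nonnegative convex functions increase. -/
def ExtConvexOrder (μ ν : MeasureTheory.Measure ℝ) : Prop :=
  ∀ φ : ℝ → ℝ, ConvexOn ℝ Set.univ φ → (∀ x, 0 ≤ φ x) →
    (∫⁻ x, ENNReal.ofReal (φ x) ∂μ) ≤ ∫⁻ x, ENNReal.ofReal (φ x) ∂ν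

/-- `π` is a transport plan with marginals `μ` and `ν`. -/
def IsCoupling (μ ν : MeasureTheory.Measure ℝ) (π : MeasureTheory.Measure (ℝ × ℝ)) : Prop :=
  π.map Prod.fst = μ ∧ π.map Prod.snd = ν

/-- `π ∈ Π_M(μ,ν)`: a coupling satisfying the martingale condition. -/
def IsMartingaleCoupling (μ ν : MeasureTheory.Measure ℝ) (π : MeasureTheory.Measure (ℝ × ℝ)) : Prop :=
  IsCoupling μ ν π ∧
  ∀ ρ : ℝ → ℝ, Continuous ρ → (∃ M : ℝ, ∀ x, |ρ x| ≤ M) →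
    (∫ p : ℝ × ℝ, ρ p.1 * (p.2 - p.1) ∂π) = 0

/-- `S` is the shadow `S^ν(μ)` of `μ` in `ν`. -/
def IsShadow (μ ν S : MeasureTheory.Measure ℝ) : Prop :=
  S ≤ ν ∧ ConvexOrder μ S ∧
  ∀ η : MeasureTheory.Measure ℝ, η ≤ ν → ConvexOrder μ η → ConvexOrder S η

/-- `π` is the left-curtain coupling between `μ` and `ν`. -/
def IsLeftCurtain (μ ν : MeasureTheory.Measure ℝ) (π : MeasureTheory.Measure (ℝ × ℝ)) : Prop :=
  IsMartingaleCoupling μ ν π ∧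
  ∀ x : ℝ, IsShadow (μ.restrict (Set.Iic x)) ν
    (MeasureTheory.Measure.map Prod.snd (π.restrict ((Set.Iic x) ×ˢ (Set.univ : Set ℝ))))

/-- `π` is left-monotone. -/
def IsLeftMonotone (π : MeasureTheory.Measure (ℝ × ℝ)) : Prop :=
  ∃ Γ : Set (ℝ × ℝ), MeasurableSet Γ ∧ π Γᶜ = 0 ∧
    ∀ x x' ym yp y' : ℝ, (x, ym) ∈ Γ → (x, yp) ∈ Γ → (x', y') ∈ Γ →
      x < x' → ym < y' → y' < yp → False

/-- The sufficient integrability condition on the cost function. -/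
def SuffInt (c : ℝ → ℝ → ℝ) (μ ν : MeasureTheory.Measure ℝ) : Prop :=
  ∃ a b : ℝ → ℝ, MeasureTheory.Integrable a μ ∧ MeasureTheory.Integrable b ν ∧
    ∀ x y : ℝ, a x + b y ≤ c x y

/-- `π` is an optimal martingale transport plan (with finite cost) for the cost `c`. -/
def IsOptimalMart (c : ℝ → ℝ → ℝ) (μ ν : MeasureTheory.Measure ℝ)
    (π : MeasureTheory.Measure (ℝ × ℝ)) : Prop :=
  IsMartingaleCoupling μ ν π ∧
  MeasureTheory.Integrable (fun p : ℝ × ℝ => c p.1 p.2) π ∧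
  ∀ π' : MeasureTheory.Measure (ℝ × ℝ), IsMartingaleCoupling μ ν π' →
    MeasureTheory.Integrable (fun p : ℝ × ℝ => c p.1 p.2) π' →
    (∫ p : ℝ × ℝ, c p.1 p.2 ∂π) ≤ ∫ p : ℝ × ℝ, c p.1 p.2 ∂π'

open scoped BoundedContinuousFunction

lemma coup_prob {μ ν : Measure ℝ} [IsProbabilityMeasure μ] {π : Measure (ℝ × ℝ)}
    (hc : IsCoupling μ ν π) : IsProbabilityMeasure π := by
  have : IsProbabilityMeasure (π.map Prod.fst) := by rw [hc.1]; infer_instance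
  exact Measure.isProbabilityMeasure_of_map Prod.fst

lemma coup_int_fst {μ ν : Measure ℝ} {π : Measure (ℝ × ℝ)} (hc : IsCoupling μ ν π)
    {a : ℝ → ℝ} (ha : Integrable a μ) :
    Integrable (fun p : ℝ × ℝ => a p.1) π ∧ ∫ p, a p.1 ∂π = ∫ x, a x ∂μ := by
  obtain ⟨h1, -⟩ := hc
  rw [← h1] at ha ⊢
  exact ⟨ha.comp_measurable measurable_fst,
    (integral_map measurable_fst.aemeasurable ha.1).symm⟩

lemma coup_int_snd {μ ν : Measure ℝ} {π : Measure (ℝ × ℝ)} (hc : IsCoupling μ ν π)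
    {a : ℝ → ℝ} (ha : Integrable a ν) :
    Integrable (fun p : ℝ × ℝ => a p.2) π ∧ ∫ p, a p.2 ∂π = ∫ x, a x ∂ν := by
  obtain ⟨-, h1⟩ := hc
  rw [← h1] at ha ⊢
  exact ⟨ha.comp_measurable measurable_snd,
    (integral_map measurable_snd.aemeasurable ha.1).symm⟩

lemma err_int {μ : Measure ℝ} [IsProbabilityMeasure μ] {a : ℝ → ℝ} (ha : Integrable a μ) (N : ℕ) :
    Integrable (fun x => max (-a x - (N : ℝ) / 2) 0) μ :=
  (ha.neg.sub (integrable_const _)).pos_part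

lemma err_tendsto {μ : Measure ℝ} [IsProbabilityMeasure μ] {a : ℝ → ℝ} (ha : Integrable a μ) :
    Tendsto (fun N : ℕ => ∫ x, max (-a x - (N : ℝ) / 2) 0 ∂μ) atTop (𝓝 0) := by
  have h0 : ∫ x, (0 : ℝ) ∂μ = 0 := by simp
  conv => arg 3; rw [← h0]
  refine tendsto_integral_of_dominated_convergence (fun x => |a x|) (fun N => (err_int ha N).1)
    ha.abs ?_ ?_
  · intro N
    refine Eventually.of_forall fun x => ?_
    have hN : (0 : ℝ) ≤ N := Nat.cast_nonneg N
    rw [Real.norm_eq_abs, abs_of_nonneg (le_max_right _ _)]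
    refine max_le ?_ (abs_nonneg _)
    have := neg_abs_le (a x)
    linarith
  · refine Eventually.of_forall fun x => ?_
    refine tendsto_const_nhds.congr' ?_
    obtain ⟨M, hM⟩ := exists_nat_ge (2 * |a x|)
    filter_upwards [eventually_ge_atTop M] with N hN
    have : (M : ℝ) ≤ N := by exact_mod_cast hN
    have := neg_abs_le (a x)
    rw [max_eq_right]
    linarith

lemma lsc_coupling {ι : Type*} {F : Filter ι} [F.NeBot] {μ ν : Measure ℝ}
    [IsProbabilityMeasure μ] [IsProbabilityMeasure ν]
    (P : ι → ProbabilityMeasure (ℝ × ℝ)) (Q : ProbabilityMeasure (ℝ × ℝ))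
    (hP : ∀ i, IsCoupling μ ν (P i)) (hQ : IsCoupling μ ν Q) (hT : Tendsto P F (𝓝 Q))
    (f : ℝ × ℝ → ℝ) (hf : Continuous f) (a b : ℝ → ℝ) (ha : Integrable a μ) (hb : Integrable b ν)
    (hab : ∀ x y, a x + b y ≤ f (x, y)) (m : ℝ)
    (hm : ∀ᶠ i in F, Integrable f (P i : Measure (ℝ × ℝ)) ∧ ∫ p, f p ∂(P i : Measure (ℝ × ℝ)) ≤ m) :
    Integrable f (Q : Measure (ℝ × ℝ)) ∧ ∫ p, f p ∂(Q : Measure (ℝ × ℝ)) ≤ m := by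
  rw [ProbabilityMeasure.tendsto_iff_forall_integral_tendsto] at hT
  set e : ℕ → ℝ := fun N => (∫ x, max (-a x - (N : ℝ) / 2) 0 ∂μ) +
    ∫ x, max (-b x - (N : ℝ) / 2) 0 ∂ν with he
  have het : Tendsto e atTop (𝓝 0) := by
    simpa using (err_tendsto ha).add (err_tendsto hb)
  let fN : ℕ → ℝ × ℝ → ℝ := fun N p => max (min (f p) N) (-N)
  have fNc : ∀ N, Continuous (fN N) := fun N => by fun_prop
  have fNb : ∀ N p, |fN N p| ≤ N := fun N p => by
    have hN : (0 : ℝ) ≤ N := Nat.cast_nonneg N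
    rw [abs_le]
    exact ⟨le_max_right _ _, max_le (min_le_right _ _) (by linarith)⟩
  have fNi : ∀ N (R : ProbabilityMeasure (ℝ × ℝ)), Integrable (fN N) (R : Measure (ℝ × ℝ)) :=
    fun N R => Integrable.of_bound (fNc N).aestronglyMeasurable N
      (Eventually.of_forall fun p => by simpa using fNb N p)
  have key : ∀ N, ∫ p, fN N p ∂(Q : Measure (ℝ × ℝ)) ≤ m + e N := by
    intro N
    let g : (ℝ × ℝ) →ᵇ ℝ := BoundedContinuousFunction.ofNormedAddCommGroup (fN N) (fNc N) N
      (fun p => by simpa using fNb N p)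
    refine le_of_tendsto (hT g) ?_
    filter_upwards [hm] with i hi
    have i1 := coup_int_fst (hP i) (err_int ha N)
    have i2 := coup_int_snd (hP i) (err_int hb N)
    calc ∫ p, fN N p ∂(P i : Measure (ℝ × ℝ))
        ≤ ∫ p, (f p + (max (-a p.1 - (N : ℝ) / 2) 0 + max (-b p.2 - (N : ℝ) / 2) 0))
            ∂(P i : Measure (ℝ × ℝ)) := by
          refine integral_mono (fNi N _) (hi.1.add (i1.1.add i2.1)) fun p => ?_
          have h1 := le_max_left (-a p.1 - (N : ℝ) / 2) 0
          have h2 := le_max_left (-b p.2 - (N : ℝ) / 2) 0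
          have h3 := le_max_right (-a p.1 - (N : ℝ) / 2) 0
          have h4 := le_max_right (-b p.2 - (N : ℝ) / 2) 0
          have h5 := hab p.1 p.2
          have h6 : min (f p) N ≤ f p := min_le_left _ _
          refine max_le ?_ ?_
          · show _ ≤ f p + _
            linarith
          · show _ ≤ f p + _
            simp only [Prod.mk.eta] at h5
            linarith
      _ = (∫ p, f p ∂(P i : Measure (ℝ × ℝ))) + e N := by
          have i12 : Integrable (fun p : ℝ × ℝ => max (-a p.1 - (N : ℝ) / 2) 0 +
            max (-b p.2 - (N : ℝ) / 2) 0) (P i : Measure (ℝ × ℝ)) := i1.1.add i2.1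
          rw [integral_add hi.1 i12, integral_add i1.1 i2.1, i1.2, i2.2]
      _ ≤ m + e N := by linarith [hi.2]
  have ja := coup_int_fst hQ ha.abs
  have jb := coup_int_snd hQ hb.abs
  set S : ℝ := (∫ x, |a x| ∂μ) + ∫ x, |b x| ∂ν with hS
  have jab : Integrable (fun p : ℝ × ℝ => |a p.1| + |b p.2|) (Q : Measure (ℝ × ℝ)) := ja.1.add jb.1
  have jabS : ∫ p : ℝ × ℝ, (|a p.1| + |b p.2|) ∂(Q : Measure (ℝ × ℝ)) = S := by
    rw [integral_add ja.1 jb.1, ja.2, jb.2]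
  have hflow : ∀ p : ℝ × ℝ, 0 ≤ f p + (|a p.1| + |b p.2|) := fun p => by
    have := hab p.1 p.2
    simp only [Prod.mk.eta] at this
    linarith [neg_abs_le (a p.1), neg_abs_le (b p.2)]
  have hGlow : ∀ N p, 0 ≤ fN N p + (|a p.1| + |b p.2|) := fun N p => by
    have h1 : min (f p) N ≤ fN N p := le_max_left _ _
    have h2 : -(|a p.1| + |b p.2|) ≤ min (f p) N := by
      refine le_min (by linarith [hflow p]) ?_
      have hN : (0 : ℝ) ≤ N := Nat.cast_nonneg N
      linarith [abs_nonneg (a p.1), abs_nonneg (b p.2)]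
    linarith
  have fatou : ∫⁻ p, ENNReal.ofReal (f p + (|a p.1| + |b p.2|)) ∂(Q : Measure (ℝ × ℝ))
      ≤ ENNReal.ofReal (m + S) := by
    have hlim : ∀ p, Tendsto (fun N : ℕ => ENNReal.ofReal (fN N p + (|a p.1| + |b p.2|))) atTop
        (𝓝 (ENNReal.ofReal (f p + (|a p.1| + |b p.2|)))) := by
      intro p
      refine tendsto_const_nhds.congr' ?_
      obtain ⟨M, hM⟩ := exists_nat_ge (|f p|)
      filter_upwards [eventually_ge_atTop M] with N hN
      have h1 : (M : ℝ) ≤ N := by exact_mod_cast hN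
      have h2 := abs_le.1 (hM.trans h1)
      have : fN N p = f p := by
        show max (min (f p) N) (-N) = f p
        rw [min_eq_left h2.2, max_eq_left h2.1]
      rw [this]
    calc ∫⁻ p, ENNReal.ofReal (f p + (|a p.1| + |b p.2|)) ∂(Q : Measure (ℝ × ℝ))
        = ∫⁻ p, liminf (fun N : ℕ => ENNReal.ofReal (fN N p + (|a p.1| + |b p.2|))) atTop
            ∂(Q : Measure (ℝ × ℝ)) := by
          refine lintegral_congr fun p => ((hlim p).liminf_eq).symm
      _ ≤ liminf (fun N : ℕ => ∫⁻ p, ENNReal.ofReal (fN N p + (|a p.1| + |b p.2|))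
            ∂(Q : Measure (ℝ × ℝ))) atTop := by
          refine lintegral_liminf_le' fun N => ?_
          exact ((fNi N Q).add jab).1.aemeasurable.ennreal_ofReal
      _ ≤ liminf (fun N : ℕ => ENNReal.ofReal (m + e N + S)) atTop := by
          refine liminf_le_liminf (Eventually.of_forall fun N => ?_)
          have hG : Integrable (fun p : ℝ × ℝ => fN N p + (|a p.1| + |b p.2|))
            (Q : Measure (ℝ × ℝ)) := (fNi N Q).add jab
          rw [← ofReal_integral_eq_lintegral_ofReal hG (Eventually.of_forall (hGlow N))]
          refine ENNReal.ofReal_le_ofReal ?_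
          rw [integral_add (fNi N Q) jab, jabS]
          linarith [key N]
      _ = ENNReal.ofReal (m + S) := by
          have : Tendsto (fun N : ℕ => ENNReal.ofReal (m + e N + S)) atTop
              (𝓝 (ENNReal.ofReal (m + 0 + S))) :=
            ENNReal.tendsto_ofReal ((tendsto_const_nhds.add het).add tendsto_const_nhds)
          rw [this.liminf_eq, add_zero]
  have hsumi : Integrable (fun p : ℝ × ℝ => f p + (|a p.1| + |b p.2|)) (Q : Measure (ℝ × ℝ)) := by
    refine ⟨hf.aestronglyMeasurable.add jab.1, ?_⟩
    rw [hasFiniteIntegral_iff_ofReal (Eventually.of_forall hflow)]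
    exact fatou.trans_lt ENNReal.ofReal_lt_top
  have hfi : Integrable f (Q : Measure (ℝ × ℝ)) := by
    have := hsumi.sub jab
    refine this.congr (Eventually.of_forall fun p => ?_)
    simp
  refine ⟨hfi, ?_⟩
  have h1 : ∫ p : ℝ × ℝ, (f p + (|a p.1| + |b p.2|)) ∂(Q : Measure (ℝ × ℝ))
      = (∫ p, f p ∂(Q : Measure (ℝ × ℝ))) + S := by
    rw [integral_add hfi jab, jabS]
  have h0 : 0 ≤ m + S := by
    by_contra hneg
    push Not at hneg
    have : ∀ᶠ N in atTop, e N < -(m + S) := het.eventually (gt_mem_nhds (by linarith))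
    obtain ⟨N, hN⟩ := this.exists
    have h2 : 0 ≤ ∫ p : ℝ × ℝ, (fN N p + (|a p.1| + |b p.2|)) ∂(Q : Measure (ℝ × ℝ)) :=
      integral_nonneg (hGlow N)
    rw [integral_add (fNi N Q) jab, jabS] at h2
    linarith [key N]
  rw [← ofReal_integral_eq_lintegral_ofReal hsumi (Eventually.of_forall hflow),
    ENNReal.ofReal_le_ofReal_iff h0, h1] at fatou
  linarith


lemma exists_opt (μ ν : Measure ℝ) [IsProbabilityMeasure μ] [IsProbabilityMeasure ν]
    (hμ : Integrable (fun x : ℝ => x) μ) (hν : Integrable (fun x : ℝ => x) ν)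
    (c : ℝ → ℝ → ℝ) (hc : Continuous (fun p : ℝ × ℝ => c p.1 p.2)) (hsi : SuffInt c μ ν)
    (hfin : ∃ π₀ : Measure (ℝ × ℝ), IsMartingaleCoupling μ ν π₀ ∧
      Integrable (fun p : ℝ × ℝ => c p.1 p.2) π₀) :
    ∃ π, IsOptimalMart c μ ν π := by
  obtain ⟨a, b, ha, hb, hab⟩ := hsi
  obtain ⟨π₀, hπ₀, hπ₀i⟩ := hfin
  let V : Set ℝ := {v | ∃ π : Measure (ℝ × ℝ), IsMartingaleCoupling μ ν π ∧
      Integrable (fun p : ℝ × ℝ => c p.1 p.2) π ∧ v = ∫ p, c p.1 p.2 ∂π}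
  have hVne : V.Nonempty := ⟨_, π₀, hπ₀, hπ₀i, rfl⟩
  have hVbd : BddBelow V := by
    refine ⟨(∫ x, a x ∂μ) + ∫ x, b x ∂ν, ?_⟩
    rintro v ⟨π, hπ, hi, rfl⟩
    have ja := coup_int_fst hπ.1 ha
    have jb := coup_int_snd hπ.1 hb
    rw [← ja.2, ← jb.2, ← integral_add ja.1 jb.1]
    exact integral_mono (ja.1.add jb.1) hi fun p => hab p.1 p.2
  set m := sInf V with hm
  have hseq : ∀ n : ℕ, ∃ π : Measure (ℝ × ℝ), IsMartingaleCoupling μ ν π ∧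
      Integrable (fun p : ℝ × ℝ => c p.1 p.2) π ∧ ∫ p, c p.1 p.2 ∂π < m + 1 / ((n : ℝ) + 1) := by
    intro n
    have : sInf V < m + 1 / ((n : ℝ) + 1) := by
      have : (0 : ℝ) < 1 / ((n : ℝ) + 1) := by positivity
      linarith
    obtain ⟨v, ⟨π, h1, h2, rfl⟩, hv⟩ := exists_lt_of_csInf_lt hVne this
    exact ⟨π, h1, h2, hv⟩
  choose p hpm hpi hpc using hseq
  let P : ℕ → ProbabilityMeasure (ℝ × ℝ) := fun n => ⟨p n, coup_prob (hpm n).1⟩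
  have hcomp : IsCompact (closure (range P)) := by
    refine isCompact_closure_of_isTightMeasureSet ?_
    refine IsTightMeasureSet.prodMk ?_ ?_
    · refine (isTightMeasureSet_singleton (μ := μ)).subset ?_
      rintro _ ⟨_, ⟨_, ⟨n, rfl⟩, rfl⟩, rfl⟩
      exact (hpm n).1.1
    · refine (isTightMeasureSet_singleton (μ := ν)).subset ?_
      rintro _ ⟨_, ⟨_, ⟨n, rfl⟩, rfl⟩, rfl⟩
      exact (hpm n).1.2
  let U : Ultrafilter ℕ := Ultrafilter.of atTop
  have hU : (U : Filter ℕ) ≤ atTop := Ultrafilter.of_le atTop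
  obtain ⟨Q, -, hQ⟩ := hcomp.ultrafilter_le_nhds (U.map P)
    (by
      rw [le_principal_iff]
      exact Filter.mem_map.2 (Filter.Eventually.of_forall fun n => subset_closure ⟨n, rfl⟩))
  have hT : Tendsto P U (𝓝 Q) := hQ
  have hQ1 : (Q : Measure (ℝ × ℝ)).map Prod.fst = μ := by
    have h1 := ProbabilityMeasure.tendsto_map_of_tendsto_of_continuous P Q hT continuous_fst
    have h2 : Tendsto (fun n => (P n).map (f := Prod.fst) continuous_fst.aemeasurable) U
        (𝓝 (⟨μ, inferInstance⟩ : ProbabilityMeasure ℝ)) := by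
      refine tendsto_const_nhds.congr fun n => ?_
      exact Subtype.ext (hpm n).1.1.symm
    have h3 := tendsto_nhds_unique h1 h2
    exact congrArg (fun R : ProbabilityMeasure ℝ => (R : Measure ℝ)) h3
  have hQ2 : (Q : Measure (ℝ × ℝ)).map Prod.snd = ν := by
    have h1 := ProbabilityMeasure.tendsto_map_of_tendsto_of_continuous P Q hT continuous_snd
    have h2 : Tendsto (fun n => (P n).map (f := Prod.snd) continuous_snd.aemeasurable) U
        (𝓝 (⟨ν, inferInstance⟩ : ProbabilityMeasure ℝ)) := by
      refine tendsto_const_nhds.congr fun n => ?_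
      exact Subtype.ext (hpm n).1.2.symm
    have h3 := tendsto_nhds_unique h1 h2
    exact congrArg (fun R : ProbabilityMeasure ℝ => (R : Measure ℝ)) h3
  have hQc : IsCoupling μ ν (Q : Measure (ℝ × ℝ)) := ⟨hQ1, hQ2⟩
  have hQm : IsMartingaleCoupling μ ν (Q : Measure (ℝ × ℝ)) := by
    refine ⟨hQc, fun ρ hρ hM => ?_⟩
    have hle : ∀ ρ : ℝ → ℝ, Continuous ρ → (∃ M : ℝ, ∀ x, |ρ x| ≤ M) →
        ∫ p : ℝ × ℝ, ρ p.1 * (p.2 - p.1) ∂(Q : Measure (ℝ × ℝ)) ≤ 0 := by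
      intro ρ hρ ⟨M, hM⟩
      have hM0 : 0 ≤ M := (abs_nonneg _).trans (hM 0)
      have hbd : ∀ x y : ℝ, |ρ x * (y - x)| ≤ M * |x| + M * |y| := by
        intro x y
        rw [abs_mul]
        calc |ρ x| * |y - x| ≤ M * (|y| + |x|) :=
              mul_le_mul (hM x) (abs_sub _ _) (abs_nonneg _) hM0
          _ = _ := by ring
      refine (lsc_coupling P Q (fun n => (hpm n).1) hQc hT
        (fun p : ℝ × ℝ => ρ p.1 * (p.2 - p.1)) (by fun_prop)
        (fun x => -(M * |x|)) (fun x => -(M * |x|)) (hμ.abs.const_mul M).neg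
        (hν.abs.const_mul M).neg ?_ 0 ?_).2
      · intro x y
        have := (abs_le.1 (hbd x y)).1
        simp only
        linarith
      · refine Eventually.of_forall fun n => ⟨?_, ((hpm n).2 ρ hρ ⟨M, hM⟩).le⟩
        refine Integrable.mono' ((coup_int_fst (hpm n).1 (hμ.abs.const_mul M)).1.add
          (coup_int_snd (hpm n).1 (hν.abs.const_mul M)).1) ?_ ?_
        · exact (by fun_prop : Continuous fun p : ℝ × ℝ => ρ p.1 * (p.2 - p.1)).aestronglyMeasurable
        · exact Eventually.of_forall fun p => hbd p.1 p.2
    refine le_antisymm (hle ρ hρ hM) ?_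
    have := hle (fun x => - ρ x) hρ.neg (by simpa using hM)
    simp only [neg_mul, integral_neg] at this
    linarith
  have hQcost : ∀ ε > 0, Integrable (fun p : ℝ × ℝ => c p.1 p.2) (Q : Measure (ℝ × ℝ)) ∧
      ∫ p : ℝ × ℝ, c p.1 p.2 ∂(Q : Measure (ℝ × ℝ)) ≤ m + ε := by
    intro ε hε
    refine lsc_coupling P Q (fun n => (hpm n).1) hQc hT _ hc a b ha hb hab (m + ε) ?_
    refine hU ?_
    have := tendsto_one_div_add_atTop_nhds_zero_nat (𝕜 := ℝ)
    filter_upwards [this.eventually (gt_mem_nhds hε)] with n hn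
    exact ⟨hpi n, by have := hpc n; exact this.le.trans (by linarith)⟩
  refine ⟨Q, hQm, (hQcost 1 one_pos).1, fun π' h1 h2 => ?_⟩
  refine le_trans (le_of_forall_pos_le_add fun ε hε => (hQcost ε hε).2) ?_
  exact csInf_le hVbd ⟨π', h1, h2, rfl⟩


lemma cost_lt {h h' : ℝ → ℝ} (hder : ∀ x : ℝ, HasDerivAt h (h' x) x)
    (hconv : StrictConvexOn ℝ Set.univ h') {x x' ym yp y' l : ℝ} (hx : x < x')
    (hy : ym < yp) (hl0 : 0 < l) (hl1 : l < 1) (hl : l * ym + (1 - l) * yp = y') :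
    l * h (ym - x') + (1 - l) * h (yp - x') + h (y' - x) <
      l * h (ym - x) + (1 - l) * h (yp - x) + h (y' - x') := by
  have hd : ∀ y t, HasDerivAt (fun t => h (y - t)) (- h' (y - t)) t := by
    intro y t
    have h1 : HasDerivAt (fun t : ℝ => y - t) (-1) t := by
      simpa using (hasDerivAt_id t).const_sub y
    have h2 := (hder (y - t)).comp t h1
    rw [mul_neg_one] at h2
    exact h2
  have hf : StrictAnti (fun t => l * h (ym - t) + (1 - l) * h (yp - t) - h (y' - t)) := by
    refine strictAnti_of_deriv_neg fun t => ?_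
    have := (((hd ym t).const_mul l).add ((hd yp t).const_mul (1 - l))).sub (hd y' t)
    have h2 := this.deriv
    change deriv (fun t => l * h (ym - t) + (1 - l) * h (yp - t) - h (y' - t)) t = _ at h2
    rw [h2]
    have h3 := hconv.2 (mem_univ (ym - t)) (mem_univ (yp - t)) (by intro h; linarith)
      hl0 (by linarith : 0 < 1 - l) (by ring)
    simp only [smul_eq_mul] at h3
    have h4 : l * (ym - t) + (1 - l) * (yp - t) = y' - t := by rw [← hl]; ring
    rw [h4] at h3
    linarith
  have := hf hx
  simp only at this
  linarith

def Wm {Ω : Type*} [MeasurableSpace Ω] {α : Type*} [MeasurableSpace α] (Λ : Measure Ω) (w : Ω → ℝ) (Z : Ω → α) :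
    Measure α := (Λ.withDensity (fun ω => ENNReal.ofReal (w ω))).map Z

lemma Wm_integrable_iff {Ω : Type*} [MeasurableSpace Ω] {Λ : Measure Ω} {w : Ω → ℝ}
    {Z : Ω → ℝ × ℝ} (hw : Measurable w) (hw0 : ∀ ω, 0 ≤ w ω) (hZ : Measurable Z) {f : ℝ × ℝ → ℝ}
    (hf : AEStronglyMeasurable f (Wm Λ w Z)) :
    Integrable f (Wm Λ w Z) ↔ Integrable (fun ω => w ω * f (Z ω)) Λ := by
  unfold Wm at *
  rw [integrable_map_measure hf hZ.aemeasurable,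
    integrable_withDensity_iff_integrable_smul' (by fun_prop) (by simp)]
  refine integrable_congr (Eventually.of_forall fun ω => ?_)
  simp [ENNReal.toReal_ofReal (hw0 ω)]

lemma Wm_integral {Ω : Type*} [MeasurableSpace Ω] {Λ : Measure Ω} {w : Ω → ℝ}
    {Z : Ω → ℝ × ℝ} (hw : Measurable w) (hw0 : ∀ ω, 0 ≤ w ω) (hZ : Measurable Z) {f : ℝ × ℝ → ℝ}
    (hf : AEStronglyMeasurable f (Wm Λ w Z)) :
    ∫ p, f p ∂(Wm Λ w Z) = ∫ ω, w ω * f (Z ω) ∂Λ := by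
  unfold Wm at *
  rw [integral_map hZ.aemeasurable hf,
    integral_withDensity_eq_integral_toReal_smul (by fun_prop) (by simp)]
  refine integral_congr_ae (Eventually.of_forall fun ω => ?_)
  simp [ENNReal.toReal_ofReal (hw0 ω)]

lemma Wm_le {Ω : Type*} [MeasurableSpace Ω] {Λ : Measure Ω} {w : Ω → ℝ}
    {Z : Ω → ℝ × ℝ} (hw1 : ∀ ω, w ω ≤ 1) (hZ : Measurable Z) :
    Wm Λ w Z ≤ Λ.map Z := by
  unfold Wm
  refine Measure.map_mono ?_ hZ
  calc Λ.withDensity (fun ω => ENNReal.ofReal (w ω)) ≤ Λ.withDensity 1 :=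
        withDensity_mono (Eventually.of_forall fun ω => by simpa using hw1 ω)
    _ = Λ := withDensity_one

lemma Wm_map {Ω : Type*} [MeasurableSpace Ω] {Λ : Measure Ω} {w : Ω → ℝ}
    {Z : Ω → ℝ × ℝ} (hZ : Measurable Z) {g : ℝ × ℝ → ℝ} (hg : Measurable g) :
    (Wm Λ w Z).map g = Wm Λ w (fun ω => g (Z ω)) := by
  unfold Wm
  rw [Measure.map_map hg hZ]; rfl

lemma Wm_split {Ω : Type*} [MeasurableSpace Ω] {Λ : Measure Ω} {w : Ω → ℝ}
    {Z : Ω → ℝ} (hw : Measurable w) (hw0 : ∀ ω, 0 ≤ w ω) (hw1 : ∀ ω, w ω ≤ 1)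
    (hZ : Measurable Z) :
    Wm Λ w Z + Wm Λ (fun ω => 1 - w ω) Z = Wm Λ (fun _ => 1) Z := by
  unfold Wm
  rw [← Measure.map_add _ _ hZ, ← withDensity_add_left (by fun_prop)]
  congr 2
  ext ω
  simp only [Pi.add_apply]
  rw [← ENNReal.ofReal_add (hw0 ω) (by linarith [hw1 ω])]
  congr 1; ring

lemma swap_zero {μ ν : Measure ℝ} [IsProbabilityMeasure μ] [IsProbabilityMeasure ν]
    (hμ : Integrable (fun x : ℝ => x) μ) (hν : Integrable (fun x : ℝ => x) ν)
    {h h' : ℝ → ℝ} (hder : ∀ x : ℝ, HasDerivAt h (h' x) x)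
    (hconv : StrictConvexOn ℝ Set.univ h')
    (hsi : SuffInt (fun x y => h (y - x)) μ ν)
    {π : Measure (ℝ × ℝ)} (hopt : IsOptimalMart (fun x y => h (y - x)) μ ν π)
    {Ω : Type*} [MeasurableSpace Ω] (Λ : Measure Ω) [IsFiniteMeasure Λ]
    (X Ym Yp X' Y' : Ω → ℝ) (hX : Measurable X) (hYm : Measurable Ym) (hYp : Measurable Yp)
    (hX' : Measurable X') (hY' : Measurable Y')
    (hbad : ∀ᵐ ω ∂Λ, X ω < X' ω ∧ Ym ω < Y' ω ∧ Y' ω < Yp ω)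
    (hle : Λ.map (fun ω => (X ω, Ym ω)) + Λ.map (fun ω => (X ω, Yp ω)) +
      Λ.map (fun ω => (X' ω, Y' ω)) ≤ π) : Λ = 0 := by
  obtain ⟨⟨hcpl, hmart⟩, hci, hmin⟩ := hopt
  obtain ⟨a, b, ha, hb, hab⟩ := hsi
  have hprob : IsProbabilityMeasure π := coup_prob hcpl
  have hcont : Continuous (fun p : ℝ × ℝ => h (p.2 - p.1)) := by
    have : Continuous h := continuous_iff_continuousAt.2 fun x => (hder x).continuousAt
    fun_prop
  let L : Ω → ℝ := fun ω => max 0 (min 1 ((Yp ω - Y' ω) / (Yp ω - Ym ω)))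
  let L' : Ω → ℝ := fun ω => 1 - L ω
  let I : Ω → ℝ := fun _ => 1
  have hL : Measurable L := by fun_prop
  have hL' : Measurable L' := by fun_prop
  have hI : Measurable I := measurable_const
  have hL0 : ∀ ω, 0 ≤ L ω := fun ω => le_max_left _ _
  have hL1 : ∀ ω, L ω ≤ 1 := fun ω => max_le zero_le_one (min_le_left _ _)
  have hL'0 : ∀ ω, 0 ≤ L' ω := fun ω => by linarith [hL1 ω, show L' ω = 1 - L ω from rfl]
  have hL'1 : ∀ ω, L' ω ≤ 1 := fun ω => by linarith [hL0 ω, show L' ω = 1 - L ω from rfl]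
  have hI0 : ∀ ω, 0 ≤ I ω := fun ω => zero_le_one
  have hI1 : ∀ ω, I ω ≤ 1 := fun ω => le_rfl
  have hLae : ∀ᵐ ω ∂Λ, X ω < X' ω ∧ Ym ω < Yp ω ∧ 0 < L ω ∧ L ω < 1 ∧
      L ω * Ym ω + (1 - L ω) * Yp ω = Y' ω := by
    filter_upwards [hbad] with ω ⟨h1, h2, h3⟩
    have hpos : 0 < Yp ω - Ym ω := by linarith
    have e1 : (Yp ω - Y' ω) / (Yp ω - Ym ω) < 1 := by rw [div_lt_one hpos]; linarith
    have e0 : 0 < (Yp ω - Y' ω) / (Yp ω - Ym ω) := div_pos (by linarith) hpos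
    have eL : L ω = (Yp ω - Y' ω) / (Yp ω - Ym ω) := by
      show max 0 (min 1 _) = _
      rw [min_eq_right e1.le, max_eq_right e0.le]
    refine ⟨h1, by linarith, by rwa [eL], by rwa [eL], ?_⟩
    rw [eL]; field_simp; ring
  have z1 : Measurable (fun ω => (X ω, Ym ω)) := by fun_prop
  have z2 : Measurable (fun ω => (X ω, Yp ω)) := by fun_prop
  have z3 : Measurable (fun ω => (X' ω, Y' ω)) := by fun_prop
  have z4 : Measurable (fun ω => (X' ω, Ym ω)) := by fun_prop
  have z5 : Measurable (fun ω => (X' ω, Yp ω)) := by fun_prop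
  have z6 : Measurable (fun ω => (X ω, Y' ω)) := by fun_prop
  set R1 := Wm Λ L (fun ω => (X ω, Ym ω)) with hR1
  set R2 := Wm Λ L' (fun ω => (X ω, Yp ω)) with hR2
  set R3 := Wm Λ I (fun ω => (X' ω, Y' ω)) with hR3
  set A1 := Wm Λ L (fun ω => (X' ω, Ym ω)) with hA1
  set A2 := Wm Λ L' (fun ω => (X' ω, Yp ω)) with hA2
  set A3 := Wm Λ I (fun ω => (X ω, Y' ω)) with hA3
  have hRle : R1 + R2 + R3 ≤ π :=
    le_trans (add_le_add (add_le_add (Wm_le hL1 z1) (Wm_le hL'1 z2)) (Wm_le hI1 z3)) hle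
  have hRfin : IsFiniteMeasure (R1 + R2 + R3) := isFiniteMeasure_of_le π hRle
  set θ := π - (R1 + R2 + R3) with hθ
  have hsum : θ + (R1 + R2 + R3) = π := Measure.sub_add_cancel_of_le hRle
  set π' := θ + (A1 + A2 + A3) with hπ'
  have hfstRA : (R1 + R2 + R3).map Prod.fst = (A1 + A2 + A3).map Prod.fst := by
    simp only [Measure.map_add _ _ measurable_fst, hR1, hR2, hR3, hA1, hA2, hA3,
      Wm_map z1 measurable_fst, Wm_map z2 measurable_fst, Wm_map z3 measurable_fst,
      Wm_map z4 measurable_fst, Wm_map z5 measurable_fst, Wm_map z6 measurable_fst]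
    rw [Wm_split hL hL0 hL1 hX, Wm_split hL hL0 hL1 hX', add_comm]
  have hsndRA : (R1 + R2 + R3).map Prod.snd = (A1 + A2 + A3).map Prod.snd := by
    simp only [Measure.map_add _ _ measurable_snd, hR1, hR2, hR3, hA1, hA2, hA3,
      Wm_map z1 measurable_snd, Wm_map z2 measurable_snd, Wm_map z3 measurable_snd,
      Wm_map z4 measurable_snd, Wm_map z5 measurable_snd, Wm_map z6 measurable_snd]
  have hcpl' : IsCoupling μ ν π' := by
    refine ⟨?_, ?_⟩
    · rw [hπ', Measure.map_add _ _ measurable_fst, ← hfstRA, ← Measure.map_add _ _ measurable_fst,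
        hsum, hcpl.1]
    · rw [hπ', Measure.map_add _ _ measurable_snd, ← hsndRA, ← Measure.map_add _ _ measurable_snd,
        hsum, hcpl.2]
  have split : ∀ {f : ℝ × ℝ → ℝ} {B1 B2 B3 : Measure (ℝ × ℝ)}, Integrable f (θ + (B1 + B2 + B3)) →
      Integrable f θ ∧ Integrable f B1 ∧ Integrable f B2 ∧ Integrable f B3 := by
    intro f B1 B2 B3 hf
    obtain ⟨h1, h2⟩ := integrable_add_measure.1 hf
    obtain ⟨h3, h4⟩ := integrable_add_measure.1 h2
    obtain ⟨h5, h6⟩ := integrable_add_measure.1 h3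
    exact ⟨h1, h5, h6, h4⟩
  have formR : ∀ {f : ℝ × ℝ → ℝ}, Integrable f π →
      (Integrable f θ ∧ Integrable (fun ω => L ω * f (X ω, Ym ω)) Λ ∧
        Integrable (fun ω => L' ω * f (X ω, Yp ω)) Λ ∧
        Integrable (fun ω => I ω * f (X' ω, Y' ω)) Λ) ∧
      ∫ p, f p ∂π = (∫ p, f p ∂θ) + ∫ ω, (L ω * f (X ω, Ym ω) + L' ω * f (X ω, Yp ω) +
        I ω * f (X' ω, Y' ω)) ∂Λ := by
    intro f hf
    rw [← hsum] at hf
    obtain ⟨h1, h2, h3, h4⟩ := split hf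
    have g2 := (Wm_integrable_iff hL hL0 z1 h2.1).1 h2
    have g3 := (Wm_integrable_iff hL' hL'0 z2 h3.1).1 h3
    have g4 := (Wm_integrable_iff hI hI0 z3 h4.1).1 h4
    refine ⟨⟨h1, g2, g3, g4⟩, ?_⟩
    have g23 : Integrable (fun ω => L ω * f (X ω, Ym ω) + L' ω * f (X ω, Yp ω)) Λ := g2.add g3
    rw [integral_add g23 g4, integral_add g2 g3, ← Wm_integral hL hL0 z1 h2.1,
      ← Wm_integral hL' hL'0 z2 h3.1, ← Wm_integral hI hI0 z3 h4.1]
    conv_lhs => rw [← hsum]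
    rw [integral_add_measure h1 ((h2.add_measure h3).add_measure h4),
      integral_add_measure (h2.add_measure h3) h4, integral_add_measure h2 h3]
  have formA : ∀ {f : ℝ × ℝ → ℝ}, Integrable f π' →
      (Integrable f θ ∧ Integrable (fun ω => L ω * f (X' ω, Ym ω)) Λ ∧
        Integrable (fun ω => L' ω * f (X' ω, Yp ω)) Λ ∧
        Integrable (fun ω => I ω * f (X ω, Y' ω)) Λ) ∧
      ∫ p, f p ∂π' = (∫ p, f p ∂θ) + ∫ ω, (L ω * f (X' ω, Ym ω) + L' ω * f (X' ω, Yp ω) +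
        I ω * f (X ω, Y' ω)) ∂Λ := by
    intro f hf
    obtain ⟨h1, h2, h3, h4⟩ := split hf
    have g2 := (Wm_integrable_iff hL hL0 z4 h2.1).1 h2
    have g3 := (Wm_integrable_iff hL' hL'0 z5 h3.1).1 h3
    have g4 := (Wm_integrable_iff hI hI0 z6 h4.1).1 h4
    refine ⟨⟨h1, g2, g3, g4⟩, ?_⟩
    have g23 : Integrable (fun ω => L ω * f (X' ω, Ym ω) + L' ω * f (X' ω, Yp ω)) Λ := g2.add g3
    rw [integral_add g23 g4, integral_add g2 g3, ← Wm_integral hL hL0 z4 h2.1,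
      ← Wm_integral hL' hL'0 z5 h3.1, ← Wm_integral hI hI0 z6 h4.1]
    rw [integral_add_measure h1 ((h2.add_measure h3).add_measure h4),
      integral_add_measure (h2.add_measure h3) h4, integral_add_measure h2 h3]
  have hmart' : IsMartingaleCoupling μ ν π' := by
    refine ⟨hcpl', fun ρ hρ hM => ?_⟩
    have h0 := hmart ρ hρ hM
    obtain ⟨M, hM⟩ := hM
    have hM0 : 0 ≤ M := (abs_nonneg _).trans (hM 0)
    have hbd : ∀ x y : ℝ, |ρ x * (y - x)| ≤ M * |x| + M * |y| := by
      intro x y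
      rw [abs_mul]
      calc |ρ x| * |y - x| ≤ M * (|y| + |x|) :=
            mul_le_mul (hM x) (abs_sub _ _) (abs_nonneg _) hM0
        _ = _ := by ring
    have hint : ∀ σ : Measure (ℝ × ℝ), IsCoupling μ ν σ →
        Integrable (fun p : ℝ × ℝ => ρ p.1 * (p.2 - p.1)) σ := by
      intro σ hσ
      refine Integrable.mono' ((coup_int_fst hσ (hμ.abs.const_mul M)).1.add
          (coup_int_snd hσ (hν.abs.const_mul M)).1) ?_ ?_
      · exact (by fun_prop : Continuous fun p : ℝ × ℝ => ρ p.1 * (p.2 - p.1)).aestronglyMeasurable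
      · exact Eventually.of_forall fun p => hbd p.1 p.2
    rw [(formR (hint π hcpl)).2] at h0
    rw [(formA (hint π' hcpl')).2, ← h0]
    congr 1
    refine integral_congr_ae ?_
    filter_upwards [hLae] with ω ⟨_, _, _, _, h5⟩
    simp only [L', I]
    rw [← h5]
    ring
  -- costs
  obtain ⟨⟨cθ, g1, g2, g3⟩, hcR⟩ := formR hci
  have hl : Integrable (fun p : ℝ × ℝ => a p.1 + b p.2) π' :=
    (coup_int_fst hcpl' ha).1.add (coup_int_snd hcpl' hb).1
  obtain ⟨⟨_, l1, l2, l3⟩, -⟩ := formA hl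
  have hlt : ∀ᵐ ω ∂Λ, L ω * h (Ym ω - X' ω) + L' ω * h (Yp ω - X' ω) + I ω * h (Y' ω - X ω) <
      L ω * h (Ym ω - X ω) + L' ω * h (Yp ω - X ω) + I ω * h (Y' ω - X' ω) := by
    filter_upwards [hLae] with ω ⟨k1, k2, k3, k4, k5⟩
    have := cost_lt hder hconv k1 k2 k3 k4 k5
    simpa only [L', I, one_mul] using this
  have hG := (g1.add g2).add g3
  have hhm : Measurable h := (continuous_iff_continuousAt.2 fun x => (hder x).continuousAt).measurable
  have low1 : ∀ ω, L ω * (a (X' ω) + b (Ym ω)) ≤ L ω * h (Ym ω - X' ω) := fun ω =>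
    mul_le_mul_of_nonneg_left (hab _ _) (hL0 ω)
  have low2 : ∀ ω, L' ω * (a (X' ω) + b (Yp ω)) ≤ L' ω * h (Yp ω - X' ω) := fun ω =>
    mul_le_mul_of_nonneg_left (hab _ _) (hL'0 ω)
  have low3 : ∀ ω, I ω * (a (X ω) + b (Y' ω)) ≤ I ω * h (Y' ω - X ω) := fun ω =>
    mul_le_mul_of_nonneg_left (hab _ _) (hI0 ω)
  have f1 : Integrable (fun ω => L ω * h (Ym ω - X' ω)) Λ := by
    refine integrable_of_le_of_le (Measurable.aestronglyMeasurable (by fun_prop))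
      (Eventually.of_forall low1) ?_ l1 ((hG.sub l2).sub l3)
    filter_upwards [hlt] with ω hω
    have := low2 ω; have := low3 ω
    simp only [Pi.sub_apply, Pi.add_apply]
    linarith
  have f2 : Integrable (fun ω => L' ω * h (Yp ω - X' ω)) Λ := by
    refine integrable_of_le_of_le (Measurable.aestronglyMeasurable (by fun_prop))
      (Eventually.of_forall low2) ?_ l2 ((hG.sub l1).sub l3)
    filter_upwards [hlt] with ω hω
    have := low1 ω; have := low3 ω
    simp only [Pi.sub_apply, Pi.add_apply]
    linarith
  have f3 : Integrable (fun ω => I ω * h (Y' ω - X ω)) Λ := by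
    refine integrable_of_le_of_le (Measurable.aestronglyMeasurable (by fun_prop))
      (Eventually.of_forall low3) ?_ l3 ((hG.sub l1).sub l2)
    filter_upwards [hlt] with ω hω
    have := low1 ω; have := low2 ω
    simp only [Pi.sub_apply, Pi.add_apply]
    linarith
  have hci' : Integrable (fun p : ℝ × ℝ => h (p.2 - p.1)) π' := by
    refine cθ.add_measure ((Integrable.add_measure ?_ ?_).add_measure ?_)
    · exact (Wm_integrable_iff hL hL0 z4 hcont.aestronglyMeasurable).2 f1
    · exact (Wm_integrable_iff hL' hL'0 z5 hcont.aestronglyMeasurable).2 f2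
    · exact (Wm_integrable_iff hI hI0 z6 hcont.aestronglyMeasurable).2 f3
  have hopt := hmin π' hmart' hci'
  rw [hcR, (formA hci').2] at hopt
  have hF := (f1.add f2).add f3
  have hdiff : ∫ ω, ((L ω * h (Ym ω - X ω) + L' ω * h (Yp ω - X ω) + I ω * h (Y' ω - X' ω)) -
      (L ω * h (Ym ω - X' ω) + L' ω * h (Yp ω - X' ω) + I ω * h (Y' ω - X ω))) ∂Λ ≤ 0 := by
    have e := integral_sub hG hF
    simp only [Pi.add_apply] at e
    rw [e]
    linarith
  have hnn : 0 ≤ᵐ[Λ] fun ω => ((L ω * h (Ym ω - X ω) + L' ω * h (Yp ω - X ω) + I ω * h (Y' ω - X' ω)) -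
      (L ω * h (Ym ω - X' ω) + L' ω * h (Yp ω - X' ω) + I ω * h (Y' ω - X ω))) := by
    filter_upwards [hlt] with ω hω
    simp only [Pi.zero_apply]
    linarith
  have hz := (integral_eq_zero_iff_of_nonneg_ae hnn (hG.sub hF)).1
    (le_antisymm hdiff (integral_nonneg_of_ae hnn))
  have : ∀ᵐ ω ∂Λ, False := by
    filter_upwards [hz, hlt] with ω h1 h2
    simp only [Pi.zero_apply] at h1
    linarith
  simpa [Filter.eventually_false_iff_eq_bot, ae_eq_bot] using this


open ProbabilityTheory in
lemma map_pair1 (μ : Measure ℝ) [IsProbabilityMeasure μ] (κ : Kernel ℝ ℝ) [IsMarkovKernel κ] :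
    (μ ⊗ₘ (κ ×ₖ κ)).map (fun p : ℝ × (ℝ × ℝ) => (p.1, p.2.1)) = μ ⊗ₘ κ := by
  have hm : Measurable (fun p : ℝ × (ℝ × ℝ) => (p.1, p.2.1)) := by fun_prop
  ext s hs
  rw [Measure.map_apply hm hs, Measure.compProd_apply (hm hs), Measure.compProd_apply hs]
  refine lintegral_congr fun x => ?_
  rw [Kernel.prod_apply]
  have : Prod.mk x ⁻¹' ((fun p : ℝ × (ℝ × ℝ) => (p.1, p.2.1)) ⁻¹' s) =
      (Prod.mk x ⁻¹' s) ×ˢ univ := by ext; simp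
  rw [this, Measure.prod_prod]; simp

open ProbabilityTheory in
lemma map_pair2 (μ : Measure ℝ) [IsProbabilityMeasure μ] (κ : Kernel ℝ ℝ) [IsMarkovKernel κ] :
    (μ ⊗ₘ (κ ×ₖ κ)).map (fun p : ℝ × (ℝ × ℝ) => (p.1, p.2.2)) = μ ⊗ₘ κ := by
  have hm : Measurable (fun p : ℝ × (ℝ × ℝ) => (p.1, p.2.2)) := by fun_prop
  ext s hs
  rw [Measure.map_apply hm hs, Measure.compProd_apply (hm hs), Measure.compProd_apply hs]
  refine lintegral_congr fun x => ?_
  rw [Kernel.prod_apply]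
  have : Prod.mk x ⁻¹' ((fun p : ℝ × (ℝ × ℝ) => (p.1, p.2.2)) ⁻¹' s) =
      univ ×ˢ (Prod.mk x ⁻¹' s) := by ext; simp
  rw [this, Measure.prod_prod]; simp

open ProbabilityTheory in
lemma box_zero {μ ν : Measure ℝ} [IsProbabilityMeasure μ] [IsProbabilityMeasure ν]
    (hμ : Integrable (fun x : ℝ => x) μ) (hν : Integrable (fun x : ℝ => x) ν)
    {h h' : ℝ → ℝ} (hder : ∀ x : ℝ, HasDerivAt h (h' x) x)
    (hconv : StrictConvexOn ℝ Set.univ h')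
    (hsi : SuffInt (fun x y => h (y - x)) μ ν)
    {π : Measure (ℝ × ℝ)} (hopt : IsOptimalMart (fun x y => h (y - x)) μ ν π)
    (κ : Kernel ℝ ℝ) [IsMarkovKernel κ] (hκ : μ ⊗ₘ κ = π) (q r s : ℝ) :
    μ {x | x ≤ s ∧ κ x (Iio q) ≠ 0 ∧ κ x (Ioi r) ≠ 0} = 0 ∨ π (Ioi s ×ˢ Ioo q r) = 0 := by
  have hprob : IsProbabilityMeasure π := coup_prob hopt.1.1
  let Λ0 : Measure ((ℝ × (ℝ × ℝ)) × (ℝ × ℝ)) := (μ ⊗ₘ (κ ×ₖ κ)).prod π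
  let S : Set ((ℝ × (ℝ × ℝ)) × (ℝ × ℝ)) := (Iic s ×ˢ (Iio q ×ˢ Ioi r)) ×ˢ (Ioi s ×ˢ Ioo q r)
  have hS : MeasurableSet S := (measurableSet_Iic.prod (measurableSet_Iio.prod measurableSet_Ioi)).prod
    (measurableSet_Ioi.prod measurableSet_Ioo)
  have m1 : Λ0.map (fun ω => (ω.1.1, ω.1.2.1)) = π := by
    have : (fun ω : (ℝ × (ℝ × ℝ)) × (ℝ × ℝ) => (ω.1.1, ω.1.2.1)) =
      (fun p : ℝ × (ℝ × ℝ) => (p.1, p.2.1)) ∘ Prod.fst := rfl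
    rw [this, ← Measure.map_map (by fun_prop) (by fun_prop), Measure.map_fst_prod]
    simp [map_pair1, hκ]
  have m2 : Λ0.map (fun ω => (ω.1.1, ω.1.2.2)) = π := by
    have : (fun ω : (ℝ × (ℝ × ℝ)) × (ℝ × ℝ) => (ω.1.1, ω.1.2.2)) =
      (fun p : ℝ × (ℝ × ℝ) => (p.1, p.2.2)) ∘ Prod.fst := rfl
    rw [this, ← Measure.map_map (by fun_prop) (by fun_prop), Measure.map_fst_prod]
    simp [map_pair2, hκ]
  have m3 : Λ0.map (fun ω => (ω.2.1, ω.2.2)) = π := by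
    change Λ0.map Prod.snd = π
    rw [Measure.map_snd_prod]; simp
  let t : NNReal := 1 / 3
  let Λ := t • Λ0.restrict S
  have hz : Λ = 0 := by
    refine swap_zero hμ hν hder hconv hsi hopt Λ (fun ω => ω.1.1) (fun ω => ω.1.2.1)
      (fun ω => ω.1.2.2) (fun ω => ω.2.1) (fun ω => ω.2.2) (by fun_prop) (by fun_prop)
      (by fun_prop) (by fun_prop) (by fun_prop) ?_ ?_
    · refine Measure.ae_smul_measure ?_ t
      filter_upwards [ae_restrict_mem hS] with ω hω
      obtain ⟨⟨h1, h2, h3⟩, h4, h5, h6⟩ := hω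
      simp only [mem_Iic, mem_Iio, mem_Ioi] at *
      exact ⟨by linarith, by linarith, by linarith⟩
    · have key : ∀ Z : (ℝ × (ℝ × ℝ)) × (ℝ × ℝ) → ℝ × ℝ, Measurable Z → Λ0.map Z = π →
          Λ.map Z ≤ t • π := by
        intro Z hZ hZπ
        rw [← hZπ, ← Measure.map_smul]
        refine Measure.map_mono ?_ hZ
        refine Measure.le_iff.2 fun s _ => ?_
        simp only [Λ, Measure.smul_apply, ENNReal.smul_def, smul_eq_mul]
        gcongr
        exact Measure.restrict_le_self
      refine (add_le_add (add_le_add (key _ (by fun_prop) m1) (key _ (by fun_prop) m2))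
        (key _ (by fun_prop) m3)).trans_eq ?_
      rw [← add_smul, ← add_smul]
      have : t + t + t = 1 := by
        ext; simp [t]; norm_num
      rw [this, one_smul]
  have hz2 : Λ0 S = 0 := by
    have : Λ univ = 0 := by rw [hz]; simp
    simpa [Λ, t, ENNReal.smul_def] using this
  simp only [Λ0, S, Measure.prod_prod, mul_eq_zero] at hz2
  refine hz2.imp_left fun h0 => ?_
  rw [Measure.compProd_apply_prod measurableSet_Iic (measurableSet_Iio.prod measurableSet_Ioi)] at h0
  simp only [Kernel.prod_apply, Measure.prod_prod] at h0
  have hmeas : Measurable (fun x => κ x (Iio q) * κ x (Ioi r)) :=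
    (κ.measurable_coe measurableSet_Iio).mul (κ.measurable_coe measurableSet_Ioi)
  rw [lintegral_eq_zero_iff hmeas, Filter.EventuallyEq, ae_restrict_iff' measurableSet_Iic] at h0
  refine measure_mono_null ?_ h0
  intro x ⟨h1, h2, h3⟩
  simp [h1, h2, h3]

open ProbabilityTheory in
lemma leftMono_of_opt {μ ν : Measure ℝ} [IsProbabilityMeasure μ] [IsProbabilityMeasure ν]
    (hμ : Integrable (fun x : ℝ => x) μ) (hν : Integrable (fun x : ℝ => x) ν)
    {h h' : ℝ → ℝ} (hder : ∀ x : ℝ, HasDerivAt h (h' x) x)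
    (hconv : StrictConvexOn ℝ Set.univ h')
    (hsi : SuffInt (fun x y => h (y - x)) μ ν)
    {π : Measure (ℝ × ℝ)} (hopt : IsOptimalMart (fun x y => h (y - x)) μ ν π) :
    IsLeftMonotone π := by
  have hprob : IsProbabilityMeasure π := coup_prob hopt.1.1
  let κ := π.condKernel
  have hfst : π.fst = μ := hopt.1.1.1
  have hκ : μ ⊗ₘ κ = π := by rw [← hfst]; exact π.disintegrate κ
  have hbox := box_zero hμ hν hder hconv hsi hopt κ hκ
  let A : ℚ → ℚ → ℚ → Set ℝ := fun q r s =>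
    {x | x ≤ (s : ℝ) ∧ κ x (Iio (q : ℝ)) ≠ 0 ∧ κ x (Ioi (r : ℝ)) ≠ 0}
  have hA : ∀ q r s, MeasurableSet (A q r s) := fun q r s =>
    measurableSet_Iic.inter (((κ.measurable_coe measurableSet_Iio) (measurableSet_singleton 0).compl).inter
      ((κ.measurable_coe measurableSet_Ioi) (measurableSet_singleton 0).compl))
  -- the conditions
  let C1 : ℚ → Set (ℝ × ℝ) := fun q => {p | p.2 < q → κ p.1 (Iio (q : ℝ)) ≠ 0}
  let C2 : ℚ → Set (ℝ × ℝ) := fun q => {p | (q : ℝ) < p.2 → κ p.1 (Ioi (q : ℝ)) ≠ 0}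
  let C3 : ℚ → ℚ → ℚ → Set (ℝ × ℝ) := fun q r s => {p | μ (A q r s) = 0 → p.1 ∉ A q r s}
  let C4 : ℚ → ℚ → ℚ → Set (ℝ × ℝ) := fun q r s =>
    {p | π (Ioi (s : ℝ) ×ˢ Ioo (q : ℝ) r) = 0 → p ∉ Ioi (s : ℝ) ×ˢ Ioo (q : ℝ) r}
  have hC1 : ∀ q, MeasurableSet (C1 q) := fun q => by
    refine (measurableSet_lt measurable_snd measurable_const).imp ?_
    exact ((κ.measurable_coe measurableSet_Iio).comp measurable_fst) (measurableSet_singleton 0).compl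
  have hC2 : ∀ q, MeasurableSet (C2 q) := fun q => by
    refine (measurableSet_lt measurable_const measurable_snd).imp ?_
    exact ((κ.measurable_coe measurableSet_Ioi).comp measurable_fst) (measurableSet_singleton 0).compl
  have hC3 : ∀ q r s, MeasurableSet (C3 q r s) := fun q r s => by
    refine (MeasurableSet.const _).imp ?_
    exact (measurable_fst (hA q r s)).compl
  have hC4 : ∀ q r s, MeasurableSet (C4 q r s) := fun q r s => by
    refine (MeasurableSet.const _).imp ?_
    exact (measurableSet_Ioi.prod measurableSet_Ioo).compl
  have nC1 : ∀ q, ∀ᵐ p ∂π, p ∈ C1 q := fun q => by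
    rw [← hκ]
    refine Measure.ae_compProd_of_ae_ae (hC1 q) (Eventually.of_forall fun x => ?_)
    by_cases h0 : κ x (Iio (q : ℝ)) = 0
    · filter_upwards [measure_eq_zero_iff_ae_notMem.1 h0] with y hy
      intro hlt
      exact absurd hlt hy
    · exact Eventually.of_forall fun y _ => h0
  have nC2 : ∀ q, ∀ᵐ p ∂π, p ∈ C2 q := fun q => by
    rw [← hκ]
    refine Measure.ae_compProd_of_ae_ae (hC2 q) (Eventually.of_forall fun x => ?_)
    by_cases h0 : κ x (Ioi (q : ℝ)) = 0
    · filter_upwards [measure_eq_zero_iff_ae_notMem.1 h0] with y hy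
      intro hlt
      exact absurd hlt hy
    · exact Eventually.of_forall fun y _ => h0
  have nC3 : ∀ q r s, ∀ᵐ p ∂π, p ∈ C3 q r s := fun q r s => by
    by_cases h0 : μ (A q r s) = 0
    · have : π (Prod.fst ⁻¹' A q r s) = 0 := by
        rw [← Measure.map_apply measurable_fst (hA q r s), hopt.1.1.1, h0]
      filter_upwards [measure_eq_zero_iff_ae_notMem.1 this] with p hp _
      exact hp
    · exact Eventually.of_forall fun p hp => absurd hp h0
  have nC4 : ∀ q r s, ∀ᵐ p ∂π, p ∈ C4 q r s := fun q r s => by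
    by_cases h0 : π (Ioi (s : ℝ) ×ˢ Ioo (q : ℝ) r) = 0
    · filter_upwards [measure_eq_zero_iff_ae_notMem.1 h0] with p hp _
      exact hp
    · exact Eventually.of_forall fun p hp => absurd hp h0
  refine ⟨(⋂ q, C1 q) ∩ (⋂ q, C2 q) ∩ (⋂ q, ⋂ r, ⋂ s, C3 q r s) ∩ (⋂ q, ⋂ r, ⋂ s, C4 q r s), ?_, ?_, ?_⟩
  · refine (((MeasurableSet.iInter hC1).inter (MeasurableSet.iInter hC2)).inter ?_).inter ?_
    · exact .iInter fun q => .iInter fun r => .iInter fun s => hC3 q r s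
    · exact .iInter fun q => .iInter fun r => .iInter fun s => hC4 q r s
  · have : ∀ᵐ p ∂π, p ∈ (⋂ q, C1 q) ∩ (⋂ q, C2 q) ∩ (⋂ q, ⋂ r, ⋂ s, C3 q r s) ∩
        (⋂ q, ⋂ r, ⋂ s, C4 q r s) := by
      filter_upwards [ae_all_iff.2 nC1, ae_all_iff.2 nC2,
        ae_all_iff.2 fun q => ae_all_iff.2 fun r => ae_all_iff.2 (nC3 q r),
        ae_all_iff.2 fun q => ae_all_iff.2 fun r => ae_all_iff.2 (nC4 q r)] with p h1 h2 h3 h4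
      simp only [mem_inter_iff, mem_iInter]
      exact ⟨⟨⟨h1, h2⟩, h3⟩, h4⟩
    exact this
  · intro x x' ym yp y' h1 h2 h3 hx hy1 hy2
    simp only [mem_inter_iff, mem_iInter] at h1 h2 h3
    obtain ⟨s, hs1, hs2⟩ := exists_rat_btwn hx
    obtain ⟨q, hq1, hq2⟩ := exists_rat_btwn hy1
    obtain ⟨r, hr1, hr2⟩ := exists_rat_btwn hy2
    have hxA : x ∈ A q r s := ⟨hs1.le, h1.1.1.1 q hq1, h2.1.1.2 r hr2⟩
    rcases hbox q r s with h0 | h0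
    · exact h1.1.2 q r s h0 hxA
    · exact h3.2 q r s h0 ⟨hs2, hq2, hr1⟩


def Cp (M : Measure ℝ) (k : ℝ) : ℝ := ∫ y, max (y - k) 0 ∂M

lemma Cp_int {M : Measure ℝ} [IsFiniteMeasure M] (hM : Integrable (fun y : ℝ => y) M) (k : ℝ) :
    Integrable (fun y : ℝ => max (y - k) 0) M := (hM.sub (integrable_const k)).pos_part

lemma Cp_cont {M : Measure ℝ} [IsFiniteMeasure M] (hM : Integrable (fun y : ℝ => y) M) :
    Continuous (Cp M) := by
  rw [continuous_iff_continuousAt]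
  intro k₀
  unfold Cp
  refine tendsto_integral_filter_of_dominated_convergence (fun y => |y| + (|k₀| + 1)) ?_ ?_ ?_ ?_
  · exact Eventually.of_forall fun k => (Cp_int hM k).1
  · filter_upwards [Metric.ball_mem_nhds k₀ one_pos] with k hk
    refine Eventually.of_forall fun y => ?_
    rw [Metric.mem_ball, Real.dist_eq] at hk
    rw [Real.norm_eq_abs, abs_of_nonneg (le_max_right _ _)]
    refine max_le ?_ (by positivity)
    have h1 := (abs_lt.1 hk).1
    linarith [le_abs_self y, neg_abs_le k₀]
  · exact hM.abs.add (integrable_const _)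
  · refine Eventually.of_forall fun y => ?_
    have : Continuous fun k : ℝ => max (y - k) 0 := by fun_prop
    exact this.tendsto k₀

lemma Cp_top {M : Measure ℝ} [IsFiniteMeasure M] (hM : Integrable (fun y : ℝ => y) M) :
    Tendsto (Cp M) atTop (𝓝 0) := by
  have h0 : ∫ y, (0 : ℝ) ∂M = 0 := by simp
  conv => arg 3; rw [← h0]
  unfold Cp
  refine tendsto_integral_filter_of_dominated_convergence (fun y => |y|) ?_ ?_ hM.abs ?_
  · exact Eventually.of_forall fun k => (Cp_int hM k).1
  · filter_upwards [eventually_ge_atTop 0] with k hk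
    refine Eventually.of_forall fun y => ?_
    rw [Real.norm_eq_abs, abs_of_nonneg (le_max_right _ _)]
    refine max_le ?_ (abs_nonneg _)
    linarith [le_abs_self y]
  · refine Eventually.of_forall fun y => ?_
    refine tendsto_const_nhds.congr' ?_
    filter_upwards [eventually_ge_atTop y] with k hk
    rw [max_eq_right (by linarith)]

lemma Cp_bot {M : Measure ℝ} [IsFiniteMeasure M] (hM : Integrable (fun y : ℝ => y) M) :
    Tendsto (fun k => Cp M k - ((∫ y, y ∂M) - k * M.real univ)) atBot (𝓝 0) := by
  have h0 : ∫ y, (0 : ℝ) ∂M = 0 := by simp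
  have h1 : (fun k => Cp M k - ((∫ y, y ∂M) - k * M.real univ)) =
      fun k => ∫ y, (max (y - k) 0 - (y - k)) ∂M := by
    ext k
    have hyk : Integrable (fun y : ℝ => y - k) M := hM.sub (integrable_const k)
    rw [integral_sub (Cp_int hM k) hyk,
      integral_sub hM (integrable_const k)]
    simp [Cp, mul_comm]
  rw [h1]
  conv => arg 3; rw [← h0]
  refine tendsto_integral_filter_of_dominated_convergence (fun y => |y|) ?_ ?_ hM.abs ?_
  · exact Eventually.of_forall fun k => ((Cp_int hM k).sub (hM.sub (integrable_const k))).1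
  · filter_upwards [eventually_le_atBot 0] with k hk
    refine Eventually.of_forall fun y => ?_
    have e : max (y - k) 0 - (y - k) = max 0 (k - y) := by
      rw [← max_sub_sub_right]; congr 1 <;> ring
    rw [e, Real.norm_eq_abs, abs_of_nonneg (le_max_left _ _)]
    refine max_le (abs_nonneg _) ?_
    linarith [neg_abs_le y]
  · refine Eventually.of_forall fun y => ?_
    refine tendsto_const_nhds.congr' ?_
    filter_upwards [eventually_le_atBot y] with k hk
    rw [max_eq_left (by linarith)]; ring

lemma Cp_le {M₁ M₂ : Measure ℝ} [IsFiniteMeasure M₁] [IsFiniteMeasure M₂]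
    (h₁ : Integrable (fun y : ℝ => y) M₁) (h₂ : Integrable (fun y : ℝ => y) M₂)
    (hmass : M₁.real univ = M₂.real univ) (hmean : ∫ y, y ∂M₁ = ∫ y, y ∂M₂)
    (U : Set ℝ) (hU : ∀ k, k ∉ U → Cp M₁ k = Cp M₂ k)
    (hU' : ∀ k ∈ U, ∃ δ > 0, Cp M₁ (k + δ) + Cp M₁ (k - δ) - 2 * Cp M₁ k =
      Cp M₂ (k + δ) + Cp M₂ (k - δ) - 2 * Cp M₂ k) (k₀ : ℝ) : Cp M₁ k₀ ≤ Cp M₂ k₀ := by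
  by_contra hlt
  push Not at hlt
  set D : ℝ → ℝ := fun k => Cp M₁ k - Cp M₂ k with hD
  have hDc : Continuous D := (Cp_cont h₁).sub (Cp_cont h₂)
  have hDt : Tendsto D atTop (𝓝 0) := by simpa using (Cp_top h₁).sub (Cp_top h₂)
  have hDb : Tendsto D atBot (𝓝 0) := by
    have := (Cp_bot h₁).sub (Cp_bot h₂)
    rw [hmass, hmean, sub_zero] at this
    refine this.congr fun k => ?_
    simp only [hD]; ring
  have hpos : 0 < D k₀ := by simp only [hD]; linarith
  obtain ⟨k₁, hk₁⟩ := hDc.exists_forall_ge' k₀ (by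
    rw [cocompact_eq_atBot_atTop, eventually_sup]
    exact ⟨(hDb.eventually (gt_mem_nhds hpos)).mono fun _ h => h.le,
      (hDt.eventually (gt_mem_nhds hpos)).mono fun _ h => h.le⟩)
  have hpos1 : 0 < D k₁ := hpos.trans_le (hk₁ k₀)
  let K : Set ℝ := {k | D k = D k₁}
  have hKc : IsClosed K := isClosed_eq hDc continuous_const
  have hKb : BddAbove K := by
    obtain ⟨B, hB⟩ := eventually_atTop.1 (hDt.eventually (gt_mem_nhds hpos1))
    refine ⟨B, fun k hk => ?_⟩
    by_contra hc
    push Not at hc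
    have := hB k hc.le
    have hk' : D k = D k₁ := hk
    linarith
  have hmem : sSup K ∈ K := hKc.csSup_mem ⟨k₁, rfl⟩ hKb
  set s := sSup K with hs
  have hsK : D s = D k₁ := hmem
  have hsU : s ∈ U := by
    by_contra hc
    have := hU s hc
    have : D s = 0 := by simp only [hD]; linarith
    linarith
  obtain ⟨δ, hδ, he⟩ := hU' s hsU
  have a1 := hk₁ (s + δ)
  have a2 := hk₁ (s - δ)
  have : s + δ ∈ K := by
    show D (s + δ) = D k₁
    simp only [hD] at a1 a2 hsK ⊢
    linarith
  have := le_csSup hKb this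
  linarith

lemma Cp_ext {M₁ M₂ : Measure ℝ} [IsFiniteMeasure M₁] [IsFiniteMeasure M₂]
    (h₁ : Integrable (fun y : ℝ => y) M₁) (h₂ : Integrable (fun y : ℝ => y) M₂)
    (hmass : M₁.real univ = M₂.real univ) (hC : ∀ k, Cp M₁ k = Cp M₂ k) : M₁ = M₂ := by
  have key : ∀ (M : Measure ℝ) [IsFiniteMeasure M], Integrable (fun y : ℝ => y) M → ∀ k,
      Tendsto (fun n : ℕ => ((n : ℝ) + 1) * (Cp M k - Cp M (k + 1 / ((n : ℝ) + 1)))) atTop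
        (𝓝 (M.real (Ioi k))) := by
    intro M _ hM k
    rw [← integral_indicator_one measurableSet_Ioi]
    have e : (fun n : ℕ => ((n : ℝ) + 1) * (Cp M k - Cp M (k + 1 / ((n : ℝ) + 1)))) =
        fun n : ℕ => ∫ y, ((n : ℝ) + 1) * (max (y - k) 0 - max (y - (k + 1 / ((n : ℝ) + 1))) 0) ∂M := by
      ext n
      rw [integral_const_mul, integral_sub (Cp_int hM _) (Cp_int hM _)]; rfl
    rw [e]
    refine tendsto_integral_of_dominated_convergence (fun _ => 1) ?_ (integrable_const _) ?_ ?_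
    · exact fun n => (((Cp_int hM _).sub (Cp_int hM _)).const_mul _).1
    · intro n
      refine Eventually.of_forall fun y => ?_
      have hn : (0 : ℝ) < (n : ℝ) + 1 := by positivity
      have hd : ((n : ℝ) + 1) * (1 / ((n : ℝ) + 1)) = 1 := by field_simp
      set d := 1 / ((n : ℝ) + 1)
      have hd0 : 0 < d := by positivity
      have u1 : 0 ≤ max (y - k) 0 - max (y - (k + d)) 0 := by
        have : max (y - (k + d)) 0 ≤ max (y - k) 0 := max_le_max (by linarith) le_rfl
        linarith
      have u2 : max (y - k) 0 - max (y - (k + d)) 0 ≤ d := by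
        have : max (y - k) 0 ≤ max (y - (k + d)) 0 + d := by
          refine max_le ?_ ?_
          · linarith [le_max_left (y - (k + d)) 0]
          · linarith [le_max_right (y - (k + d)) 0]
        linarith
      rw [Real.norm_eq_abs, abs_of_nonneg (mul_nonneg hn.le u1)]
      calc _ ≤ ((n : ℝ) + 1) * d := mul_le_mul_of_nonneg_left u2 hn.le
        _ = 1 := hd
    · refine Eventually.of_forall fun y => ?_
      refine tendsto_const_nhds.congr' ?_
      by_cases hy : k < y
      · have := tendsto_one_div_add_atTop_nhds_zero_nat (𝕜 := ℝ)
        filter_upwards [this.eventually (gt_mem_nhds (sub_pos.2 hy))] with n hn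
        have hn0 : (0 : ℝ) < (n : ℝ) + 1 := by positivity
        rw [indicator_of_mem (by exact hy), max_eq_left (by linarith), max_eq_left (by linarith)]
        simp only [Pi.one_apply]
        field_simp
        ring
      · refine Eventually.of_forall fun n => ?_
        have hn0 : (0 : ℝ) < 1 / ((n : ℝ) + 1) := by positivity
        push Not at hy
        have e1 : max (y - k) 0 = 0 := max_eq_right (by linarith)
        have e2 : max (y - (k + 1/((n:ℝ)+1))) 0 = 0 := max_eq_right (by linarith)
        rw [indicator_of_notMem (by simpa using hy)]
        show (0:ℝ) = ((n:ℝ)+1) * (max (y - k) 0 - max (y - (k + 1/((n:ℝ)+1))) 0)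
        rw [e1, e2]
        simp
  refine Measure.ext_of_Iic M₁ M₂ fun k => ?_
  have h3 : M₁.real (Ioi k) = M₂.real (Ioi k) := by
    refine tendsto_nhds_unique (key M₁ h₁ k) ?_
    simp only [hC]
    exact key M₂ h₂ k
  have h4 : M₁.real (Iic k) = M₂.real (Iic k) := by
    rw [← compl_Ioi, measureReal_compl measurableSet_Ioi, measureReal_compl measurableSet_Ioi, h3,
      hmass]
  exact (measureReal_eq_measureReal_iff).1 h4

open scoped ProbabilityTheory

lemma bary {μ ν : Measure ℝ} [IsProbabilityMeasure μ] [IsProbabilityMeasure ν]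
    (hμ : Integrable (fun x : ℝ => x) μ) (hν : Integrable (fun x : ℝ => x) ν)
    {π : Measure (ℝ × ℝ)} [IsProbabilityMeasure π] (hm : IsMartingaleCoupling μ ν π) :
    ∀ᵐ x ∂μ, Integrable (fun y : ℝ => y) (π.condKernel x) ∧ ∫ y, y ∂(π.condKernel x) = x := by
  have hfst : π.fst = μ := hm.1.1
  have hκ : μ ⊗ₘ π.condKernel = π := by rw [← hfst]; exact π.disintegrate π.condKernel
  have i1 := (coup_int_fst hm.1 hμ).1
  have i2 := (coup_int_snd hm.1 hν).1
  have i3 : Integrable (fun p : ℝ × ℝ => p.2 - p.1) π := i2.sub i1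
  have hI : ∀ᵐ x ∂μ, Integrable (fun y : ℝ => y) (π.condKernel x) := by
    have i2' := i2
    rw [← hκ, Measure.integrable_compProd_iff (by fun_prop)] at i2'
    exact i2'.1
  have hmI : Integrable (fun x => ∫ y, (y - x) ∂(π.condKernel x)) μ := by
    have := i3.integral_condKernel
    rwa [hfst] at this
  have hz : ∀ᵐ x ∂μ, ∫ y, (y - x) ∂(π.condKernel x) = 0 := by
    refine ae_eq_zero_of_integral_contDiff_smul_eq_zero hmI.locallyIntegrable ?_
    intro g hg hgc
    have hgcont : Continuous g := hg.continuous
    obtain ⟨C, hC⟩ := hgc.exists_bound_of_continuous hgcont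
    have h0 := hm.2 g hgcont ⟨C, fun x => by simpa using hC x⟩
    have i4 : Integrable (fun p : ℝ × ℝ => g p.1 * (p.2 - p.1)) π :=
      i3.bdd_mul (c := C) (by fun_prop) (Eventually.of_forall fun p => hC p.1)
    have e := Measure.integral_compProd (μ := μ) (κ := π.condKernel) (by rw [hκ]; exact i4)
    rw [hκ, h0] at e
    rw [e]
    refine integral_congr_ae (Eventually.of_forall fun x => ?_)
    simp only [smul_eq_mul]
    rw [integral_const_mul]
  filter_upwards [hI, hz] with x h1 h2
  refine ⟨h1, ?_⟩
  rw [integral_sub h1 (integrable_const x)] at h2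
  simp at h2
  linarith

def Mt (π : Measure (ℝ × ℝ)) (t : ℝ) : Measure ℝ :=
  (π.restrict (Iic t ×ˢ univ)).map Prod.snd

instance Mt_fin (π : Measure (ℝ × ℝ)) [IsFiniteMeasure π] (t : ℝ) : IsFiniteMeasure (Mt π t) := by
  unfold Mt; infer_instance

lemma Mt_apply (π : Measure (ℝ × ℝ)) (t : ℝ) {B : Set ℝ} (hB : MeasurableSet B) :
    Mt π t B = π (Iic t ×ˢ B) := by
  unfold Mt
  rw [Measure.map_apply measurable_snd hB, Measure.restrict_apply (measurable_snd hB)]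
  congr 1
  ext p
  simp [and_comm]

lemma Mt_int {π : Measure (ℝ × ℝ)} (t : ℝ) {f : ℝ → ℝ} (hf : Continuous f) :
    ∫ y, f y ∂(Mt π t) = ∫ p in Iic t ×ˢ univ, f p.2 ∂π := by
  unfold Mt
  rw [integral_map measurable_snd.aemeasurable (by fun_prop)]

lemma Mt_first {μ ν : Measure ℝ} (hν : Integrable (fun x : ℝ => x) ν)
    {π : Measure (ℝ × ℝ)} (hm : IsMartingaleCoupling μ ν π) (t : ℝ) :
    Integrable (fun y : ℝ => y) (Mt π t) := by
  unfold Mt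
  rw [integrable_map_measure (by fun_prop) measurable_snd.aemeasurable]
  exact (coup_int_snd hm.1 hν).1.integrableOn

lemma Mt_kernel {μ ν : Measure ℝ} [IsProbabilityMeasure μ] [IsProbabilityMeasure ν]
    (hν : Integrable (fun x : ℝ => x) ν)
    {π : Measure (ℝ × ℝ)} [IsProbabilityMeasure π] (hm : IsMartingaleCoupling μ ν π) (t : ℝ)
    {f g : ℝ → ℝ} (hf : Continuous f) (hfi : Integrable f ν)
    (hfg : ∀ᵐ x ∂μ, x ≤ t → ∫ y, f y ∂(π.condKernel x) = g x) :
    ∫ y, f y ∂(Mt π t) = ∫ x in Iic t, g x ∂μ := by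
  have hfst : π.fst = μ := hm.1.1
  have hκ : μ ⊗ₘ π.condKernel = π := by rw [← hfst]; exact π.disintegrate π.condKernel
  rw [Mt_int t hf]
  have e := Measure.setIntegral_compProd (μ := μ) (κ := π.condKernel) (s := Iic t) measurableSet_Iic
    (t := univ) MeasurableSet.univ (f := fun p => f p.2)
    (by rw [hκ]; exact (coup_int_snd hm.1 hfi).1.integrableOn)
  rw [hκ] at e
  rw [e]
  refine setIntegral_congr_ae measurableSet_Iic ?_
  filter_upwards [hfg] with x hx hxt
  rw [Measure.restrict_univ]
  exact hx hxt

lemma Mt_mass {μ ν : Measure ℝ} {π : Measure (ℝ × ℝ)} (hm : IsMartingaleCoupling μ ν π) (t : ℝ) :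
    (Mt π t).real univ = μ.real (Iic t) := by
  rw [Measure.real, Mt_apply _ _ MeasurableSet.univ, Measure.real, ← hm.1.1,
    Measure.map_apply measurable_fst measurableSet_Iic]
  congr 2
  ext p; simp

lemma Mt_mean {μ ν : Measure ℝ} [IsProbabilityMeasure μ] [IsProbabilityMeasure ν]
    (hμ : Integrable (fun x : ℝ => x) μ) (hν : Integrable (fun x : ℝ => x) ν)
    {π : Measure (ℝ × ℝ)} [IsProbabilityMeasure π] (hm : IsMartingaleCoupling μ ν π) (t : ℝ) :
    ∫ y, y ∂(Mt π t) = ∫ x in Iic t, x ∂μ := by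
  refine Mt_kernel hν hm t continuous_id hν ?_
  filter_upwards [bary hμ hν hm] with x hx _
  exact hx.2

def Us (Γ : Set (ℝ × ℝ)) (t : ℝ) : Set ℝ :=
  {k | ∃ x ym yp, x ≤ t ∧ (x, ym) ∈ Γ ∧ (x, yp) ∈ Γ ∧ ym < k ∧ k < yp}

lemma Mt_notU {μ ν : Measure ℝ} [IsProbabilityMeasure μ] [IsProbabilityMeasure ν]
    (hμ : Integrable (fun x : ℝ => x) μ) (hν : Integrable (fun x : ℝ => x) ν)
    {π : Measure (ℝ × ℝ)} [IsProbabilityMeasure π] (hm : IsMartingaleCoupling μ ν π) (t : ℝ)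
    {Γ : Set (ℝ × ℝ)} (hΓ : π Γᶜ = 0) {k : ℝ} (hk : k ∉ Us Γ t) :
    Cp (Mt π t) k = ∫ x in Iic t, max (x - k) 0 ∂μ := by
  have hfst : π.fst = μ := hm.1.1
  have hκ : μ ⊗ₘ π.condKernel = π := by rw [← hfst]; exact π.disintegrate π.condKernel
  have hae : ∀ᵐ p ∂(μ ⊗ₘ π.condKernel), p ∈ Γ := by rw [hκ]; exact hΓ
  unfold Cp
  refine Mt_kernel hν hm t (by fun_prop) (Cp_int hν k) ?_
  filter_upwards [bary hμ hν hm, Measure.ae_ae_of_ae_compProd hae] with x hx hx2 hxt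
  obtain ⟨hi, hb⟩ := hx
  by_cases hs : ∃ y, (x, y) ∈ Γ ∧ y < k
  · obtain ⟨ym, hym, hymk⟩ := hs
    have h1 : ∀ᵐ y ∂(π.condKernel x), y ≤ k := by
      filter_upwards [hx2] with y hy
      by_contra hc
      push Not at hc
      exact hk ⟨x, ym, y, hxt, hym, hy, hymk, hc⟩
    have hxk : x ≤ k := by
      have := integral_mono_ae hi (integrable_const k) h1
      rw [hb] at this
      simpa using this
    rw [max_eq_right (by linarith)]
    refine integral_eq_zero_of_ae ?_
    filter_upwards [h1] with y hy
    exact max_eq_right (by linarith)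
  · push Not at hs
    have h1 : ∀ᵐ y ∂(π.condKernel x), k ≤ y := by
      filter_upwards [hx2] with y hy
      exact hs y hy
    have hxk : k ≤ x := by
      have := integral_mono_ae (integrable_const k) hi h1
      rw [hb] at this
      simpa using this
    rw [max_eq_left (by linarith)]
    have : ∫ y, max (y - k) 0 ∂(π.condKernel x) = ∫ y, (y - k) ∂(π.condKernel x) := by
      refine integral_congr_ae ?_
      filter_upwards [h1] with y hy
      exact max_eq_left (by linarith)
    rw [this, integral_sub hi (integrable_const k), hb]
    simp

lemma Mt_U {μ ν : Measure ℝ} [IsProbabilityMeasure μ] [IsProbabilityMeasure ν]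
    (hν : Integrable (fun x : ℝ => x) ν)
    {π : Measure (ℝ × ℝ)} [IsProbabilityMeasure π] (hm : IsMartingaleCoupling μ ν π) (t : ℝ)
    {Γ : Set (ℝ × ℝ)} (hΓ : π Γᶜ = 0)
    (hmono : ∀ x x' ym yp y' : ℝ, (x, ym) ∈ Γ → (x, yp) ∈ Γ → (x', y') ∈ Γ →
      x < x' → ym < y' → y' < yp → False) {x ym yp k δ : ℝ} (hxt : x ≤ t)
    (hym : (x, ym) ∈ Γ) (hyp : (x, yp) ∈ Γ) (hδ : 0 < δ) (h1 : ym < k - δ) (h2 : k + δ < yp) :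
    Cp (Mt π t) (k + δ) + Cp (Mt π t) (k - δ) - 2 * Cp (Mt π t) k =
      ∫ y, (max (y - (k + δ)) 0 + max (y - (k - δ)) 0 - 2 * max (y - k) 0) ∂ν := by
  have hMi := Mt_first hν hm t
  have e : Cp (Mt π t) (k + δ) + Cp (Mt π t) (k - δ) - 2 * Cp (Mt π t) k =
      ∫ y, (max (y - (k + δ)) 0 + max (y - (k - δ)) 0 - 2 * max (y - k) 0) ∂(Mt π t) := by
    have a1 : Integrable (fun y : ℝ => max (y - (k + δ)) 0 + max (y - (k - δ)) 0) (Mt π t) :=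
      (Cp_int hMi _).add (Cp_int hMi _)
    have a2 : Integrable (fun y : ℝ => 2 * max (y - k) 0) (Mt π t) := (Cp_int hMi _).const_mul 2
    rw [integral_sub a1 a2, integral_add (Cp_int hMi _) (Cp_int hMi _), integral_const_mul]
    rfl
  have hν' : Integrable (fun y : ℝ =>
      max (y - (k + δ)) 0 + max (y - (k - δ)) 0 - 2 * max (y - k) 0) ν :=
    ((Cp_int hν _).add (Cp_int hν _)).sub ((Cp_int hν _).const_mul 2)
  rw [e, Mt_int t (by fun_prop), ← (coup_int_snd hm.1 hν').2]
  refine setIntegral_eq_integral_of_ae_compl_eq_zero ?_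
  have hae : ∀ᵐ p ∂π, p ∈ Γ := hΓ
  filter_upwards [hae] with p hp hpt
  have hpt' : t < p.1 := by simpa using hpt
  by_cases hc : ym < p.2
  · have hc2 : yp ≤ p.2 := by
      by_contra hcc
      push Not at hcc
      exact hmono x p.1 ym yp p.2 hym hyp hp (by linarith) hc hcc
    rw [max_eq_left (by linarith), max_eq_left (by linarith), max_eq_left (by linarith)]
    ring
  · push Not at hc
    rw [max_eq_right (by linarith), max_eq_right (by linarith), max_eq_right (by linarith)]
    ring

lemma mono_unique {μ ν : Measure ℝ} [IsProbabilityMeasure μ] [IsProbabilityMeasure ν]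
    (hμ : Integrable (fun x : ℝ => x) μ) (hν : Integrable (fun x : ℝ => x) ν)
    {π₁ π₂ : Measure (ℝ × ℝ)} (hm₁ : IsMartingaleCoupling μ ν π₁) (hm₂ : IsMartingaleCoupling μ ν π₂)
    {Γ : Set (ℝ × ℝ)} (hΓ₁ : π₁ Γᶜ = 0) (hΓ₂ : π₂ Γᶜ = 0)
    (hmono : ∀ x x' ym yp y' : ℝ, (x, ym) ∈ Γ → (x, yp) ∈ Γ → (x', y') ∈ Γ →
      x < x' → ym < y' → y' < yp → False) : π₁ = π₂ := by
  have p1 : IsProbabilityMeasure π₁ := coup_prob hm₁.1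
  have p2 : IsProbabilityMeasure π₂ := coup_prob hm₂.1
  have hM : ∀ t, Mt π₁ t = Mt π₂ t := by
    intro t
    have i₁ := Mt_first hν hm₁ t
    have i₂ := Mt_first hν hm₂ t
    have hmass : (Mt π₁ t).real univ = (Mt π₂ t).real univ := by
      rw [Mt_mass hm₁, Mt_mass hm₂]
    have hmean : ∫ y, y ∂(Mt π₁ t) = ∫ y, y ∂(Mt π₂ t) := by
      rw [Mt_mean hμ hν hm₁, Mt_mean hμ hν hm₂]
    have hU : ∀ k, k ∉ Us Γ t → Cp (Mt π₁ t) k = Cp (Mt π₂ t) k := fun k hk => by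
      rw [Mt_notU hμ hν hm₁ t hΓ₁ hk, Mt_notU hμ hν hm₂ t hΓ₂ hk]
    have hU' : ∀ k ∈ Us Γ t, ∃ δ > 0,
        Cp (Mt π₁ t) (k + δ) + Cp (Mt π₁ t) (k - δ) - 2 * Cp (Mt π₁ t) k =
        Cp (Mt π₂ t) (k + δ) + Cp (Mt π₂ t) (k - δ) - 2 * Cp (Mt π₂ t) k := by
      rintro k ⟨x, ym, yp, hxt, hym, hyp, h1, h2⟩
      obtain ⟨δ, hδ, hδ2⟩ := exists_between (lt_min (sub_pos.2 h1) (sub_pos.2 h2))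
      have b1 := hδ2.trans_le (min_le_left _ _)
      have b2 := hδ2.trans_le (min_le_right _ _)
      refine ⟨δ, hδ, ?_⟩
      rw [Mt_U hν hm₁ t hΓ₁ hmono hxt hym hyp hδ (by linarith) (by linarith),
        Mt_U hν hm₂ t hΓ₂ hmono hxt hym hyp hδ (by linarith) (by linarith)]
    refine Cp_ext i₁ i₂ hmass fun k => le_antisymm ?_ ?_
    · exact Cp_le i₁ i₂ hmass hmean _ hU hU' k
    · refine Cp_le i₂ i₁ hmass.symm hmean.symm _ (fun k hk => (hU k hk).symm) (fun k hk => ?_) k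
      obtain ⟨δ, hδ, he⟩ := hU' k hk
      exact ⟨δ, hδ, he.symm⟩
  refine Measure.ext_prod ?_
  intro s B hs hB
  have hrep : ∀ π : Measure (ℝ × ℝ), ∀ s : Set ℝ, MeasurableSet s →
      ((π.restrict (univ ×ˢ B)).map Prod.fst) s = π (s ×ˢ B) := by
    intro π s hs
    rw [Measure.map_apply measurable_fst hs, Measure.restrict_apply (measurable_fst hs)]
    congr 1
    ext p
    simp
  have heq : (π₁.restrict (univ ×ˢ B)).map Prod.fst = (π₂.restrict (univ ×ˢ B)).map Prod.fst := by
    refine Measure.ext_of_Iic _ _ fun t => ?_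
    rw [hrep _ _ measurableSet_Iic, hrep _ _ measurableSet_Iic, ← Mt_apply _ _ hB,
      ← Mt_apply _ _ hB, hM]
  rw [← hrep π₁ s hs, ← hrep π₂ s hs, heq]

lemma half_opt {c : ℝ → ℝ → ℝ} {μ ν : Measure ℝ} [IsProbabilityMeasure μ] [IsProbabilityMeasure ν]
    (hμ : Integrable (fun x : ℝ => x) μ) (hν : Integrable (fun x : ℝ => x) ν)
    {π₁ π₂ : Measure (ℝ × ℝ)} (h₁ : IsOptimalMart c μ ν π₁) (h₂ : IsOptimalMart c μ ν π₂) :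
    IsOptimalMart c μ ν ((2⁻¹ : ENNReal) • π₁ + (2⁻¹ : ENNReal) • π₂) := by
  have h2 : (2⁻¹ : ENNReal) ≠ ⊤ := by simp
  have key : ∀ f : ℝ × ℝ → ℝ, Integrable f π₁ → Integrable f π₂ →
      Integrable f ((2⁻¹ : ENNReal) • π₁ + (2⁻¹ : ENNReal) • π₂) ∧
      ∫ p, f p ∂((2⁻¹ : ENNReal) • π₁ + (2⁻¹ : ENNReal) • π₂) =
        (∫ p, f p ∂π₁ + ∫ p, f p ∂π₂) / 2 := by
    intro f hf1 hf2
    have a1 := hf1.smul_measure h2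
    have a2 := hf2.smul_measure h2
    refine ⟨a1.add_measure a2, ?_⟩
    rw [integral_add_measure a1 a2, integral_smul_measure, integral_smul_measure]
    simp
    ring
  have hs : ∀ m : Measure ℝ, (2⁻¹ : ENNReal) • m + (2⁻¹ : ENNReal) • m = m := by
    intro m
    rw [← add_smul, ENNReal.inv_two_add_inv_two, one_smul]
  have hp1 : IsProbabilityMeasure π₁ := coup_prob h₁.1.1
  have hp2 : IsProbabilityMeasure π₂ := coup_prob h₂.1.1
  refine ⟨⟨⟨?_, ?_⟩, ?_⟩, (key _ h₁.2.1 h₂.2.1).1, ?_⟩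
  · rw [Measure.map_add _ _ measurable_fst, Measure.map_smul, Measure.map_smul, h₁.1.1.1,
      h₂.1.1.1, hs]
  · rw [Measure.map_add _ _ measurable_snd, Measure.map_smul, Measure.map_smul, h₁.1.1.2,
      h₂.1.1.2, hs]
  · intro ρ hρ hb
    have hI : ∀ π : Measure (ℝ × ℝ), IsMartingaleCoupling μ ν π →
        Integrable (fun p : ℝ × ℝ => ρ p.1 * (p.2 - p.1)) π := by
      intro π hπ
      obtain ⟨C, hC⟩ := hb
      have i3 : Integrable (fun p : ℝ × ℝ => p.2 - p.1) π :=
        (coup_int_snd hπ.1 hν).1.sub (coup_int_fst hπ.1 hμ).1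
      exact i3.bdd_mul (c := C) (by fun_prop) (Eventually.of_forall fun p => by simpa using hC p.1)
    rw [(key _ (hI π₁ h₁.1) (hI π₂ h₂.1)).2, h₁.1.2 ρ hρ hb, h₂.1.2 ρ hρ hb]
    simp
  · intro π' hπ' hi
    rw [(key _ h₁.2.1 h₂.2.1).2]
    have b1 := h₁.2.2 π' hπ' hi
    have b2 := h₂.2.2 π' hπ' hi
    linarith

/-- for costs `c(x,y) = h(y-x)` with `h'` strictly convex, there is
exactly one optimal martingale transport plan, and it is left-monotone. -/
theorem optimal_unique_and_leftMonotone_of_strictlyConvex_deriv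
    (μ ν : MeasureTheory.Measure ℝ)
    [MeasureTheory.IsProbabilityMeasure μ] [MeasureTheory.IsProbabilityMeasure ν]
    (hμ : MeasureTheory.Integrable (fun x : ℝ => x) μ)
    (hν : MeasureTheory.Integrable (fun x : ℝ => x) ν)
    (hord : ConvexOrder μ ν)
    (h h' : ℝ → ℝ)
    (hder : ∀ x : ℝ, HasDerivAt h (h' x) x)
    (hconv : StrictConvexOn ℝ Set.univ h')
    (hsi : SuffInt (fun x y => h (y - x)) μ ν)
    (hfin : ∃ π₀ : MeasureTheory.Measure (ℝ × ℝ), IsMartingaleCoupling μ ν π₀ ∧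
      MeasureTheory.Integrable (fun p : ℝ × ℝ => h (p.2 - p.1)) π₀) :
    (∃! π : MeasureTheory.Measure (ℝ × ℝ), IsOptimalMart (fun x y => h (y - x)) μ ν π) ∧
    ∀ π : MeasureTheory.Measure (ℝ × ℝ),
      IsOptimalMart (fun x y => h (y - x)) μ ν π → IsLeftMonotone π := by
  have hcont : Continuous h := continuous_iff_continuousAt.2 fun x => (hder x).continuousAt
  obtain ⟨π, hπ⟩ := exists_opt μ ν hμ hν (fun x y => h (y - x)) (by fun_prop) hsi hfin
  refine ⟨⟨π, hπ, ?_⟩, fun π' hπ' => leftMono_of_opt hμ hν hder hconv hsi hπ'⟩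
  intro π' hπ'
  obtain ⟨Γ, -, hΓ, hmono⟩ := leftMono_of_opt hμ hν hder hconv hsi (half_opt hμ hν hπ' hπ)
  rw [Measure.add_apply, Measure.smul_apply, Measure.smul_apply] at hΓ
  simp only [smul_eq_mul, add_eq_zero, mul_eq_zero, ENNReal.inv_eq_zero, ENNReal.ofNat_ne_top,
    false_or] at hΓ
  exact mono_unique hμ hν hπ'.1 hπ.1 hΓ.1 hΓ.2 hmono
end
end

section
/- Let μ ≤C ν be probability measures on ℝ with finite first moments, with μ atomless. Let h : ℝ → ℝ be twice continuously differentiable such that for every a, b ∈ ℝ the set {t ∈ ℝ : h'(t) = a·t + b} has at most k elements, let c(x,y) = h(y−x) satisfy the sufficient integrability condition with respect to μ and ν, and let π ∈ Π_M(μ,ν) be optimal for c with ∫ c dπ finite. Then for μ-almost every x ∈ ℝ, the support of the conditional measure π_x has at most k elements. -/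
open MeasureTheory Set Filter Topology

noncomputable section

/-- weighted push-forward -/
def wm {Z : Type*} [MeasurableSpace Z] (M : Measure Z) (w : Z → ℝ) (r : Z → ℝ × ℝ) :
    Measure (ℝ × ℝ) := (M.withDensity (fun z => ENNReal.ofReal (w z))).map r

lemma wm_le {Z : Type*} [MeasurableSpace Z] (M : Measure Z) (w : Z → ℝ) (r : Z → ℝ × ℝ)
    (hr : Measurable r) (hw : ∀ᵐ z ∂M, w z ≤ 1 / 3) (π : Measure (ℝ × ℝ)) (h : M.map r ≤ π) :
    wm M w r ≤ (3 : ENNReal)⁻¹ • π := by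
  have h1 : M.withDensity (fun z => ENNReal.ofReal (w z)) ≤ (3 : ENNReal)⁻¹ • M := by
    rw [← withDensity_const]
    apply withDensity_mono
    filter_upwards [hw] with z hz
    calc ENNReal.ofReal (w z) ≤ ENNReal.ofReal (1/3) := ENNReal.ofReal_le_ofReal hz
      _ = _ := by
        rw [one_div, ENNReal.ofReal_inv_of_pos (by norm_num)]
        norm_num
  calc wm M w r ≤ ((3 : ENNReal)⁻¹ • M).map r := Measure.map_mono h1 hr
    _ = (3 : ENNReal)⁻¹ • M.map r := Measure.map_smul _ _ _
    _ ≤ _ := by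
      intro s
      simp only [Measure.smul_apply, smul_eq_mul]
      exact mul_le_mul_right (h s) _

lemma wm_int {Z : Type*} [MeasurableSpace Z] (M : Measure Z) [IsFiniteMeasure M] (w : Z → ℝ)
    (r : Z → ℝ × ℝ) (hr : Measurable r) (hwm : Measurable w) (hw : ∀ᵐ z ∂M, 0 ≤ w z ∧ w z ≤ 1 / 3)
    (K : ℝ) (hK : ∀ᵐ z ∂M, |(r z).1| ≤ K ∧ |(r z).2| ≤ K)
    (φ : ℝ × ℝ → ℝ) (hφ : Continuous φ) :
    Integrable φ (wm M w r) ∧ Integrable (fun z => w z * φ (r z)) M ∧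
      ∫ p, φ p ∂(wm M w r) = ∫ z, w z * φ (r z) ∂M := by
  have hm : Measurable (fun z => ENNReal.ofReal (w z)) := hwm.ennreal_ofReal
  have I : Integrable (fun z => w z * φ (r z)) M := by
    have hc : IsCompact ((Icc (-K) K) ×ˢ (Icc (-K) K) : Set (ℝ × ℝ)) :=
      isCompact_Icc.prod isCompact_Icc
    obtain ⟨C, hC⟩ := hc.exists_bound_of_continuousOn hφ.continuousOn
    apply Integrable.of_bound (C := 1 / 3 * C)
    · exact (hwm.mul (hφ.measurable.comp hr)).aestronglyMeasurable
    · filter_upwards [hw, hK] with z h1 h2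
      rw [norm_mul]
      have := hC (r z) ⟨abs_le.1 h2.1, abs_le.1 h2.2⟩
      have h3 : ‖w z‖ ≤ 1 / 3 := by
        rw [Real.norm_eq_abs, abs_of_nonneg h1.1]; exact h1.2
      gcongr
  have E : (fun z => (ENNReal.ofReal (w z)).toReal • φ (r z)) =ᵐ[M] (fun z => w z * φ (r z)) := by
    filter_upwards [hw] with z h1
    rw [ENNReal.toReal_ofReal h1.1, smul_eq_mul]
  refine ⟨?_, I, ?_⟩
  · unfold wm
    rw [integrable_map_measure hφ.aestronglyMeasurable hr.aemeasurable,
      integrable_withDensity_iff_integrable_smul₀' hm.aemeasurable (by simp)]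
    exact I.congr E.symm
  · unfold wm
    rw [integral_map hr.aemeasurable hφ.aestronglyMeasurable,
      integral_withDensity_eq_integral_toReal_smul₀ hm.aemeasurable (by simp)]
    exact integral_congr_ae E

lemma wm_map {Z : Type*} [MeasurableSpace Z] (M : Measure Z) (w : Z → ℝ)
    (r : Z → ℝ × ℝ) (hr : Measurable r) (g : ℝ × ℝ → ℝ) (hg : Measurable g) :
    (wm M w r).map g = (M.withDensity (fun z => ENNReal.ofReal (w z))).map (fun z => g (r z)) := by
  unfold wm
  rw [Measure.map_map hg hr]; rfl

lemma int3 {Z : Type*} [MeasurableSpace Z] {M : Measure Z} {f g k : Z → ℝ} (hf : Integrable f M)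
    (hg : Integrable g M) (hk : Integrable k M) : Integrable (fun z => f z + g z + k z) M ∧
    ∫ z, (f z + g z + k z) ∂M = ∫ z, f z ∂M + ∫ z, g z ∂M + ∫ z, k z ∂M := by
  have hfg : Integrable (fun z => f z + g z) M := hf.add hg
  exact ⟨hfg.add hk, by rw [integral_add hfg hk, integral_add hf hg]⟩

lemma pert {Z : Type*} [MeasurableSpace Z] (μ ν : Measure ℝ) [IsProbabilityMeasure μ]
    [IsProbabilityMeasure ν]
    (hμ : Integrable (fun x : ℝ => x) μ) (hν : Integrable (fun x : ℝ => x) ν)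
    (c : ℝ → ℝ → ℝ) (hc : Continuous (fun p : ℝ × ℝ => c p.1 p.2)) (π : Measure (ℝ × ℝ))
    [IsFiniteMeasure π]
    (hopt : IsOptimalMart c μ ν π) (M : Measure Z) [IsFiniteMeasure M]
    (x x' y1 y2 y3 : Z → ℝ) (hx : Measurable x) (hx' : Measurable x') (hy1 : Measurable y1)
    (hy2 : Measurable y2) (hy3 : Measurable y3) (K : ℝ)
    (hK : ∀ᵐ z ∂M, |x z| ≤ K ∧ |x' z| ≤ K ∧ |y1 z| ≤ K ∧ |y2 z| ≤ K ∧ |y3 z| ≤ K)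
    (hord : ∀ᵐ z ∂M, y1 z < y2 z ∧ y2 z < y3 z)
    (h1 : M.map (fun z => (x z, y1 z)) ≤ π) (h3 : M.map (fun z => (x z, y3 z)) ≤ π)
    (h2 : M.map (fun z => (x' z, y2 z)) ≤ π)
    (hF : ∀ᵐ z ∂M, (y3 z - y2 z) * (c (x' z) (y1 z) - c (x z) (y1 z))
      + (y2 z - y1 z) * (c (x' z) (y3 z) - c (x z) (y3 z))
      - (y3 z - y1 z) * (c (x' z) (y2 z) - c (x z) (y2 z)) < 0) : M = 0 := by
  obtain ⟨⟨⟨hπ1, hπ2⟩, hmart⟩, hcint, hmin⟩ := hopt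
  set w1 : Z → ℝ := fun z => (y3 z - y2 z) / (3 * (y3 z - y1 z)) with hw1
  set w3 : Z → ℝ := fun z => (y2 z - y1 z) / (3 * (y3 z - y1 z)) with hw3
  set w2 : Z → ℝ := fun z => 1 / 3 with hw2
  have mw1 : Measurable w1 := by fun_prop
  have mw2 : Measurable w2 := by fun_prop
  have mw3 : Measurable w3 := by fun_prop
  have b1 : ∀ᵐ z ∂M, 0 ≤ w1 z ∧ w1 z ≤ 1 / 3 := by
    filter_upwards [hord] with z ⟨ha, hb⟩
    have : 0 < 3 * (y3 z - y1 z) := by linarith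
    refine ⟨div_nonneg (by linarith) this.le, ?_⟩
    simp only [hw1]
    rw [div_le_iff₀ this]; linarith
  have b3 : ∀ᵐ z ∂M, 0 ≤ w3 z ∧ w3 z ≤ 1 / 3 := by
    filter_upwards [hord] with z ⟨ha, hb⟩
    have : 0 < 3 * (y3 z - y1 z) := by linarith
    refine ⟨div_nonneg (by linarith) this.le, ?_⟩
    simp only [hw3]
    rw [div_le_iff₀ this]; linarith
  have b2 : ∀ᵐ z ∂M, 0 ≤ w2 z ∧ w2 z ≤ 1 / 3 := by
    filter_upwards with z
    simp only [hw2]; norm_num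
  have hsum : ∀ᵐ z ∂M, w2 z = w1 z + w3 z := by
    filter_upwards [hord] with z ⟨ha, hb⟩
    have : (y3 z - y1 z) ≠ 0 := by linarith
    simp only [hw1, hw2, hw3]; field_simp; ring
  have hbar : ∀ᵐ z ∂M, w2 z * y2 z = w1 z * y1 z + w3 z * y3 z := by
    filter_upwards [hord] with z ⟨ha, hb⟩
    have : (y3 z - y1 z) ≠ 0 := by linarith
    simp only [hw1, hw2, hw3]; field_simp; ring
  have r1 : Measurable (fun z => (x z, y1 z)) := hx.prodMk hy1
  have r2 : Measurable (fun z => (x' z, y2 z)) := hx'.prodMk hy2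
  have r3 : Measurable (fun z => (x z, y3 z)) := hx.prodMk hy3
  have a1 : Measurable (fun z => (x' z, y1 z)) := hx'.prodMk hy1
  have a2 : Measurable (fun z => (x z, y2 z)) := hx.prodMk hy2
  have a3 : Measurable (fun z => (x' z, y3 z)) := hx'.prodMk hy3
  set R1 := wm M w1 (fun z => (x z, y1 z)) with hR1
  set R2 := wm M w2 (fun z => (x' z, y2 z)) with hR2
  set R3 := wm M w3 (fun z => (x z, y3 z)) with hR3
  set A1 := wm M w1 (fun z => (x' z, y1 z)) with hA1
  set A2 := wm M w2 (fun z => (x z, y2 z)) with hA2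
  set A3 := wm M w3 (fun z => (x' z, y3 z)) with hA3
  have iR1 := wm_int M w1 _ r1 mw1 b1 K (by filter_upwards [hK] with z hz; tauto)
  have iR2 := wm_int M w2 _ r2 mw2 b2 K (by filter_upwards [hK] with z hz; tauto)
  have iR3 := wm_int M w3 _ r3 mw3 b3 K (by filter_upwards [hK] with z hz; tauto)
  have iA1 := wm_int M w1 _ a1 mw1 b1 K (by filter_upwards [hK] with z hz; tauto)
  have iA2 := wm_int M w2 _ a2 mw2 b2 K (by filter_upwards [hK] with z hz; tauto)
  have iA3 := wm_int M w3 _ a3 mw3 b3 K (by filter_upwards [hK] with z hz; tauto)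
  have hle : R1 + R2 + R3 ≤ π := by
    calc R1 + R2 + R3 ≤ (3 : ENNReal)⁻¹ • π + (3 : ENNReal)⁻¹ • π + (3 : ENNReal)⁻¹ • π :=
          add_le_add (add_le_add (wm_le M w1 _ r1 (b1.mono fun _ h => h.2) π h1)
            (wm_le M w2 _ r2 (b2.mono fun _ h => h.2) π h2))
            (wm_le M w3 _ r3 (b3.mono fun _ h => h.2) π h3)
      _ = π := by
          rw [← add_smul, ← add_smul, ENNReal.inv_three_add_inv_three, one_smul]
  have : IsFiniteMeasure (R1 + R2 + R3) := isFiniteMeasure_of_le π hle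
  set σ := π - (R1 + R2 + R3) with hσ
  have hπσ : π = σ + (R1 + R2 + R3) := (Measure.sub_add_cancel_of_le hle).symm
  have hσle : σ ≤ π := Measure.sub_le
  -- change formula
  have change : ∀ φ : ℝ × ℝ → ℝ, Continuous φ → Integrable φ π →
      Integrable φ (σ + (A1 + A2 + A3)) ∧
      Integrable (fun z => w1 z * (φ (x' z, y1 z) - φ (x z, y1 z))
        + w3 z * (φ (x' z, y3 z) - φ (x z, y3 z)) - w2 z * (φ (x' z, y2 z) - φ (x z, y2 z))) M ∧
      ∫ p, φ p ∂(σ + (A1 + A2 + A3)) = ∫ p, φ p ∂π +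
        ∫ z, (w1 z * (φ (x' z, y1 z) - φ (x z, y1 z))
        + w3 z * (φ (x' z, y3 z) - φ (x z, y3 z)) - w2 z * (φ (x' z, y2 z) - φ (x z, y2 z))) ∂M := by
    intro φ hφ hi
    obtain ⟨R1a, R1b, R1c⟩ := iR1 φ hφ
    obtain ⟨R2a, R2b, R2c⟩ := iR2 φ hφ
    obtain ⟨R3a, R3b, R3c⟩ := iR3 φ hφ
    obtain ⟨A1a, A1b, A1c⟩ := iA1 φ hφ
    obtain ⟨A2a, A2b, A2c⟩ := iA2 φ hφ
    obtain ⟨A3a, A3b, A3c⟩ := iA3 φ hφ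
    have hiσ : Integrable φ σ := hi.mono_measure hσle
    have eq : (fun z => w1 z * (φ (x' z, y1 z) - φ (x z, y1 z))
        + w3 z * (φ (x' z, y3 z) - φ (x z, y3 z)) - w2 z * (φ (x' z, y2 z) - φ (x z, y2 z)))
      = fun z => (w1 z * φ (x' z, y1 z) + w2 z * φ (x z, y2 z) + w3 z * φ (x' z, y3 z))
       - (w1 z * φ (x z, y1 z) + w2 z * φ (x' z, y2 z) + w3 z * φ (x z, y3 z)) := by
      funext z; ring
    have AI := (A1a.add_measure A2a).add_measure A3a
    have RI := (R1a.add_measure R2a).add_measure R3a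
    obtain ⟨sA, eA⟩ := int3 A1b A2b A3b
    obtain ⟨sR, eR⟩ := int3 R1b R2b R3b
    refine ⟨hiσ.add_measure AI, ?_, ?_⟩
    · rw [eq]
      exact sA.sub sR
    · rw [eq, integral_sub sA sR, eA, eR]
      rw [integral_add_measure hiσ AI, integral_add_measure (A1a.add_measure A2a) A3a,
        integral_add_measure A1a A2a]
      conv_rhs => rw [hπσ]
      rw [integral_add_measure hiσ RI, integral_add_measure (R1a.add_measure R2a) R3a,
        integral_add_measure R1a R2a, R1c, R2c, R3c, A1c, A2c, A3c]
      ring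
  have hdens : M.withDensity (fun z => ENNReal.ofReal (w2 z)) =
      M.withDensity (fun z => ENNReal.ofReal (w1 z)) +
      M.withDensity (fun z => ENNReal.ofReal (w3 z)) := by
    rw [← withDensity_add_left mw1.ennreal_ofReal]
    apply withDensity_congr_ae
    filter_upwards [hsum, b1, b3] with z hz hz1 hz3
    simp only [Pi.add_apply]
    rw [hz, ENNReal.ofReal_add hz1.1 hz3.1]
  have mart' : IsMartingaleCoupling μ ν (σ + (A1 + A2 + A3)) := by
    refine ⟨⟨?_, ?_⟩, ?_⟩
    · rw [← hπ1]
      conv_rhs => rw [hπσ]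
      simp only [Measure.map_add _ _ measurable_fst]
      rw [wm_map _ _ _ r1 _ measurable_fst, wm_map _ _ _ r2 _ measurable_fst,
        wm_map _ _ _ r3 _ measurable_fst, wm_map _ _ _ a1 _ measurable_fst,
        wm_map _ _ _ a2 _ measurable_fst, wm_map _ _ _ a3 _ measurable_fst]
      simp only [hdens, Measure.map_add _ _ hx, Measure.map_add _ _ hx']
      abel
    · rw [← hπ2]
      conv_rhs => rw [hπσ]
      simp only [Measure.map_add _ _ measurable_snd]
      rw [wm_map _ _ _ r1 _ measurable_snd, wm_map _ _ _ r2 _ measurable_snd,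
        wm_map _ _ _ r3 _ measurable_snd, wm_map _ _ _ a1 _ measurable_snd,
        wm_map _ _ _ a2 _ measurable_snd, wm_map _ _ _ a3 _ measurable_snd]
    · intro ρ hρ hb
      obtain ⟨B, hB⟩ := hb
      have i1 : Integrable (fun p : ℝ × ℝ => p.1) π := by
        rw [← hπ1] at hμ
        exact hμ.comp_measurable measurable_fst
      have i2 : Integrable (fun p : ℝ × ℝ => p.2) π := by
        rw [← hπ2] at hν
        exact hν.comp_measurable measurable_snd
      have hi : Integrable (fun p : ℝ × ℝ => ρ p.1 * (p.2 - p.1)) π :=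
        (i2.sub i1).bdd_mul (c := B) (hρ.comp continuous_fst).aestronglyMeasurable
          (ae_of_all _ fun p => hB p.1)
      obtain ⟨-, -, e⟩ := change (fun p : ℝ × ℝ => ρ p.1 * (p.2 - p.1)) (by fun_prop) hi
      rw [e, hmart ρ hρ ⟨B, hB⟩, zero_add]
      apply integral_eq_zero_of_ae
      filter_upwards [hsum, hbar] with z hz1 hz2
      simp only [Pi.zero_apply]
      linear_combination (-ρ (x' z) + ρ (x z)) * hz2 + (ρ (x' z) * x' z - ρ (x z) * x z) * hz1
  obtain ⟨ci, cj, ce⟩ := change (fun p => c p.1 p.2) hc hcint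
  have hge := hmin _ mart' ci
  rw [ce] at hge
  by_contra hM
  have hneg : ∀ᵐ z ∂M, (w1 z * (c (x' z) (y1 z) - c (x z) (y1 z))
        + w3 z * (c (x' z) (y3 z) - c (x z) (y3 z)) - w2 z * (c (x' z) (y2 z) - c (x z) (y2 z))) < 0 := by
    filter_upwards [hF, hord] with z hz ⟨ha, hb⟩
    have h0 : 0 < (y3 z - y1 z) := by linarith
    have : (w1 z * (c (x' z) (y1 z) - c (x z) (y1 z))
        + w3 z * (c (x' z) (y3 z) - c (x z) (y3 z)) - w2 z * (c (x' z) (y2 z) - c (x z) (y2 z)))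
      = ((y3 z - y2 z) * (c (x' z) (y1 z) - c (x z) (y1 z))
      + (y2 z - y1 z) * (c (x' z) (y3 z) - c (x z) (y3 z))
      - (y3 z - y1 z) * (c (x' z) (y2 z) - c (x z) (y2 z))) / (3 * (y3 z - y1 z)) := by
      simp only [hw1, hw2, hw3]; field_simp
    rw [this]
    exact div_neg_of_neg_of_pos hz (by linarith)
  have hpos := (integral_pos_iff_support_of_nonneg_ae
    (f := fun z => - (w1 z * (c (x' z) (y1 z) - c (x z) (y1 z))
        + w3 z * (c (x' z) (y3 z) - c (x z) (y3 z)) - w2 z * (c (x' z) (y2 z) - c (x z) (y2 z))))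
    (μ := M) (by filter_upwards [hneg] with z hz; simp only [Pi.zero_apply]; linarith) cj.neg).2 ?_
  · rw [integral_neg] at hpos
    linarith
  · rw [pos_iff_ne_zero]
    intro h0
    apply hM
    rw [← Measure.measure_univ_eq_zero, ← nonpos_iff_eq_zero, ← h0]
    apply measure_mono_ae
    filter_upwards [hneg] with z hz _
    exact (neg_pos.2 hz).ne'

/-- second-difference functional -/
def DD (g : ℝ → ℝ) (q : ℝ × ℝ × ℝ × ℝ) : ℝ :=
  (q.2.2.2 - q.2.1) * g (q.2.2.1 - q.1) - (q.2.2.2 - q.2.2.1) * g (q.2.1 - q.1)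
    - (q.2.2.1 - q.2.1) * g (q.2.2.2 - q.1)

lemma mvt2 (f f' : ℝ → ℝ) (hf : ∀ t, HasDerivAt f (f' t) t) (a b : ℝ) (hab : a ≠ b) :
    ∃ ξ, min a b < ξ ∧ ξ < max a b ∧ f b - f a = f' ξ * (b - a) := by
  have hc : Continuous f := continuous_iff_continuousAt.2 fun t => (hf t).continuousAt
  rcases lt_or_gt_of_ne hab with h | h
  · obtain ⟨ξ, hξ, e⟩ := exists_hasDerivAt_eq_slope f f' h hc.continuousOn (fun t _ => hf t)
    refine ⟨ξ, by simpa [h.le] using hξ.1, by simpa [h.le] using hξ.2, ?_⟩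
    rw [e, div_mul_cancel₀]; linarith
  · obtain ⟨ξ, hξ, e⟩ := exists_hasDerivAt_eq_slope f f' h hc.continuousOn (fun t _ => hf t)
    refine ⟨ξ, by simpa [h.le] using hξ.1, by simpa [h.le] using hξ.2, ?_⟩
    rw [e]
    have : a - b ≠ 0 := by linarith
    field_simp; ring

lemma mem_ball4 (p q : ℝ × ℝ × ℝ × ℝ) (r : ℝ) : q ∈ Metric.ball p r ↔
    |q.1 - p.1| < r ∧ |q.2.1 - p.2.1| < r ∧ |q.2.2.1 - p.2.2.1| < r ∧ |q.2.2.2 - p.2.2.2| < r := by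
  simp [Metric.mem_ball, Prod.dist_eq, Real.dist_eq]

open ProbabilityTheory in
lemma marg (μ : Measure ℝ) [IsProbabilityMeasure μ] (κ : Kernel ℝ ℝ) [IsMarkovKernel κ] :
    (μ ⊗ₘ (κ ×ₖ (κ ×ₖ κ))).map (fun q => (q.1, q.2.1)) = μ ⊗ₘ κ ∧
    (μ ⊗ₘ (κ ×ₖ (κ ×ₖ κ))).map (fun q => (q.1, q.2.2.1)) = μ ⊗ₘ κ ∧
    (μ ⊗ₘ (κ ×ₖ (κ ×ₖ κ))).map (fun q => (q.1, q.2.2.2)) = μ ⊗ₘ κ := by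
  refine ⟨?_, ?_, ?_⟩
  · have := (Measure.compProd_map (μ := μ) (κ := κ ×ₖ (κ ×ₖ κ)) measurable_fst)
    rw [← Kernel.fst_eq, Kernel.fst_prod] at this
    exact this.symm
  · have := (Measure.compProd_map (μ := μ) (κ := κ ×ₖ (κ ×ₖ κ))
      (measurable_fst.comp measurable_snd))
    rw [Kernel.map_comp_right _ measurable_snd measurable_fst, ← Kernel.snd_eq, Kernel.snd_prod,
      ← Kernel.fst_eq, Kernel.fst_prod] at this
    exact this.symm
  · have := (Measure.compProd_map (μ := μ) (κ := κ ×ₖ (κ ×ₖ κ))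
      (measurable_snd.comp measurable_snd))
    rw [Kernel.map_comp_right _ measurable_snd measurable_snd, ← Kernel.snd_eq, ← Kernel.snd_eq,
      Kernel.snd_prod, Kernel.snd_prod] at this
    exact this.symm

/-- positivity of ordered pairs -/
lemma pairs_pos {Q : Type*} [MeasurableSpace Q] (m : Measure Q) [IsFiniteMeasure m] (f : Q → ℝ)
    (hf : Measurable f) (hat : ∀ t, m (f ⁻¹' {t}) = 0) (W : Set Q) (hW : m W ≠ 0) (s : ℝ)
    (hs : s ≠ 0) :
    (m.prod m) {z | z.1 ∈ W ∧ z.2 ∈ W ∧ 0 < s * (f z.1 - f z.2)} ≠ 0 := by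
  intro h0
  have h1 : (m.prod m) {z | z.1 ∈ W ∧ z.2 ∈ W ∧ 0 < s * (f z.2 - f z.1)} = 0 := by
    have hq : MeasurePreserving Prod.swap (m.prod m) (m.prod m) :=
      ⟨measurable_swap, Measure.prod_swap⟩
    have := hq.quasiMeasurePreserving.preimage_null h0
    refine measure_mono_null ?_ this
    rintro z ⟨a, b, c⟩
    exact ⟨b, a, c⟩
  have h2 : (m.prod m) {z | f z.1 = f z.2} = 0 := by
    have hms : MeasurableSet {z : Q × Q | f z.1 = f z.2} :=
      measurableSet_eq_fun (hf.comp measurable_fst) (hf.comp measurable_snd)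
    rw [Measure.measure_prod_null hms]
    filter_upwards with x
    simp only [Pi.zero_apply]
    refine measure_mono_null ?_ (hat (f x))
    intro y hy
    exact hy.symm
  have h3 : (m.prod m) (W ×ˢ W) = 0 := by
    refine measure_mono_null ?_ (measure_union_null (measure_union_null h0 h1) h2)
    rintro z ⟨a, b⟩
    by_cases hz : f z.1 = f z.2
    · exact Or.inr hz
    · left
      have : s * (f z.1 - f z.2) ≠ 0 := mul_ne_zero hs (sub_ne_zero.2 hz)
      rcases lt_or_gt_of_ne this with h | h
      · right; exact ⟨a, b, by linarith⟩
      · left; exact ⟨a, b, h⟩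
  rw [Measure.prod_prod] at h3
  exact hW (by simpa using h3)

open ProbabilityTheory in
lemma key (μ ν : Measure ℝ) [IsProbabilityMeasure μ] [IsProbabilityMeasure ν]
    (hμ : Integrable (fun x : ℝ => x) μ) (hν : Integrable (fun x : ℝ => x) ν)
    (hatomless : ∀ x : ℝ, μ {x} = 0)
    (h : ℝ → ℝ) (hsm : ContDiff ℝ 2 h)
    (κ : Kernel ℝ ℝ) [IsMarkovKernel κ]
    (hopt : IsOptimalMart (fun x y => h (y - x)) μ ν (μ ⊗ₘ κ)) (s : ℝ) (hs : s ≠ 0) :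
    (μ ⊗ₘ (κ ×ₖ (κ ×ₖ κ))) {q | q.2.1 < q.2.2.1 ∧ q.2.2.1 < q.2.2.2 ∧ 0 < s * DD (deriv h) q}
      = 0 := by
  have hd : Differentiable ℝ h := hsm.differentiable (by norm_num)
  have hdc : Continuous (deriv h) := hsm.continuous_deriv (by norm_num)
  set m := μ ⊗ₘ (κ ×ₖ (κ ×ₖ κ)) with hm
  set U : Set (ℝ × ℝ × ℝ × ℝ) :=
    {q | q.2.1 < q.2.2.1 ∧ q.2.2.1 < q.2.2.2 ∧ 0 < s * DD (deriv h) q} with hU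
  by_contra hne
  have hUo : IsOpen U := by
    have c1 : Continuous (fun q : ℝ × ℝ × ℝ × ℝ => s * DD (deriv h) q) := by
      unfold DD; fun_prop
    have o1 : IsOpen {q : ℝ × ℝ × ℝ × ℝ | q.2.1 < q.2.2.1} := isOpen_lt (by fun_prop) (by fun_prop)
    have o2 : IsOpen {q : ℝ × ℝ × ℝ × ℝ | q.2.2.1 < q.2.2.2} :=
      isOpen_lt (by fun_prop) (by fun_prop)
    exact o1.inter (o2.inter (isOpen_lt continuous_const c1))
  obtain ⟨p, hpU, hp⟩ := exists_mem_forall_mem_nhdsWithin_pos_measure hne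
  obtain ⟨r, hr, hball⟩ := Metric.isOpen_iff.1 hUo p hpU
  have hW : m (Metric.ball p r) ≠ 0 :=
    (hp _ (mem_nhdsWithin_of_mem_nhds (Metric.ball_mem_nhds p hr))).ne'
  have hat : ∀ t, m (Prod.fst ⁻¹' {t}) = 0 := by
    intro t
    have : m.fst = μ := Measure.fst_compProd _ _
    rw [← Measure.fst_apply (measurableSet_singleton t), this]
    exact hatomless t
  set G : Set ((ℝ × ℝ × ℝ × ℝ) × (ℝ × ℝ × ℝ × ℝ)) :=
    {z | z.1 ∈ Metric.ball p r ∧ z.2 ∈ Metric.ball p r ∧ 0 < s * (z.1.1 - z.2.1)} with hG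
  have hGpos : (m.prod m) G ≠ 0 := pairs_pos m Prod.fst measurable_fst hat _ hW s hs
  have hGm : MeasurableSet G := by
    have c1 : Continuous (fun z : (ℝ × ℝ × ℝ × ℝ) × (ℝ × ℝ × ℝ × ℝ) => s * (z.1.1 - z.2.1)) := by
      fun_prop
    exact ((Metric.isOpen_ball.preimage continuous_fst).inter
      ((Metric.isOpen_ball.preimage continuous_snd).inter
        (isOpen_lt continuous_const c1))).measurableSet
  obtain ⟨g1, g2, g3⟩ := marg μ κ
  have m1 : (m.prod m).map Prod.fst = m := by
    rw [Measure.map_fst_prod]; simp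
  have m2 : (m.prod m).map Prod.snd = m := by
    rw [Measure.map_snd_prod]; simp
  have hz : (m.prod m).restrict G = 0 := by
    refine pert μ ν hμ hν _ (by have := hd.continuous; fun_prop) _ hopt ((m.prod m).restrict G)
      (fun z => z.1.1) (fun z => z.2.1) (fun z => z.1.2.1) (fun z => z.2.2.2.1)
      (fun z => z.1.2.2.2) (by fun_prop) (by fun_prop) (by fun_prop) (by fun_prop) (by fun_prop)
      (|p.1| + |p.2.1| + |p.2.2.1| + |p.2.2.2| + r) ?_ ?_ ?_ ?_ ?_ ?_
    · filter_upwards [ae_restrict_mem hGm] with z hz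
      obtain ⟨ha, hb, hc⟩ := hz
      rw [mem_ball4] at ha hb
      obtain ⟨u1, u2, u3, u4⟩ := ha
      obtain ⟨v1, v2, v3, v4⟩ := hb
      have P1 := abs_nonneg p.1
      have P2 := abs_nonneg p.2.1
      have P3 := abs_nonneg p.2.2.1
      have P4 := abs_nonneg p.2.2.2
      have T : ∀ a b : ℝ, |a - b| < r → |a| ≤ |b| + r := by
        intro a b hab
        have := abs_sub_abs_le_abs_sub a b
        linarith
      have t1 := T _ _ u1
      have t2 := T _ _ v1
      have t3 := T _ _ u2
      have t4 := T _ _ v3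
      have t5 := T _ _ u4
      refine ⟨?_, ?_, ?_, ?_, ?_⟩ <;> linarith
    · filter_upwards [ae_restrict_mem hGm] with z hz
      obtain ⟨ha, hb, hc⟩ := hz
      rw [mem_ball4] at ha hb
      have hq : (z.1.1, z.1.2.1, z.2.2.2.1, z.1.2.2.2) ∈ U := by
        apply hball
        rw [mem_ball4]
        exact ⟨ha.1, ha.2.1, hb.2.2.1, ha.2.2.2⟩
      exact ⟨hq.1, hq.2.1⟩
    · refine (Measure.map_mono Measure.restrict_le_self (by fun_prop)).trans (le_of_eq ?_)
      rw [← g1]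
      conv_rhs => rw [← hm, ← m1]
      rw [Measure.map_map (by fun_prop) (by fun_prop)]; rfl
    · refine (Measure.map_mono Measure.restrict_le_self (by fun_prop)).trans (le_of_eq ?_)
      rw [← g3]
      conv_rhs => rw [← hm, ← m1]
      rw [Measure.map_map (by fun_prop) (by fun_prop)]; rfl
    · refine (Measure.map_mono Measure.restrict_le_self (by fun_prop)).trans (le_of_eq ?_)
      rw [← g2]
      conv_rhs => rw [← hm, ← m2]
      rw [Measure.map_map (by fun_prop) (by fun_prop)]; rfl
    · filter_upwards [ae_restrict_mem hGm] with z hz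
      obtain ⟨ha, hb, hc⟩ := hz
      rw [mem_ball4] at ha hb
      have hne' : z.1.1 ≠ z.2.1 := by
        intro e; rw [e] at hc; simp at hc
      set y1 := z.1.2.1
      set y2 := z.2.2.2.1
      set y3 := z.1.2.2.2
      obtain ⟨ξ, l1, l2, e⟩ := mvt2
        (fun t => (y3 - y2) * h (y1 - t) + (y2 - y1) * h (y3 - t) - (y3 - y1) * h (y2 - t))
        (fun t => DD (deriv h) (t, y1, y2, y3)) (by
          intro t
          have H : ∀ y, HasDerivAt (fun t => h (y - t)) (-(deriv h (y - t))) t := by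
            intro y
            have := (hd (y - t)).hasDerivAt.comp t ((hasDerivAt_id t).const_sub y)
            simpa [Function.comp_def] using this
          have := (((H y1).const_mul (y3 - y2)).add ((H y3).const_mul (y2 - y1))).sub
            ((H y2).const_mul (y3 - y1))
          refine this.congr_deriv ?_
          simp only [DD]; ring) z.1.1 z.2.1 hne'
      have hq : (ξ, y1, y2, y3) ∈ U := by
        apply hball
        rw [mem_ball4]
        refine ⟨?_, ha.2.1, hb.2.2.1, ha.2.2.2⟩
        have A := abs_lt.1 ha.1
        have B := abs_lt.1 hb.1
        rw [abs_lt]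
        simp only [min_lt_iff, lt_max_iff] at l1 l2
        constructor
        · rcases l1 with l | l <;> linarith
        · rcases l2 with l | l <;> linarith
      have hD := hq.2.2
      have e' : (y3 - y2) * (h (y1 - z.2.1) - h (y1 - z.1.1))
        + (y2 - y1) * (h (y3 - z.2.1) - h (y3 - z.1.1))
        - (y3 - y1) * (h (y2 - z.2.1) - h (y2 - z.1.1))
        = DD (deriv h) (ξ, y1, y2, y3) * (z.2.1 - z.1.1) := by
        rw [← e]; ring
      rw [e']
      have hpos := mul_pos hD hc
      have hs2 : 0 < s * s := mul_self_pos.2 hs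
      by_contra hcon
      push Not at hcon
      have := mul_nonneg hs2.le hcon
      nlinarith
  apply hGpos
  rw [← Measure.restrict_apply_self, hz]; rfl

open ProbabilityTheory in
/-- for costs `h(y-x)` where `h'` meets every affine function in at
most `k` points, the conditional measures of an optimal martingale plan are
supported on at most `k` points (for continuous `μ`). -/
theorem optimal_mart_conditional_support_le
    (k : ℕ) (μ ν : MeasureTheory.Measure ℝ)
    [MeasureTheory.IsProbabilityMeasure μ] [MeasureTheory.IsProbabilityMeasure ν]
    (hμ : MeasureTheory.Integrable (fun x : ℝ => x) μ)
    (hν : MeasureTheory.Integrable (fun x : ℝ => x) ν)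
    (hord : ConvexOrder μ ν)
    (hatomless : ∀ x : ℝ, μ {x} = 0)
    (h : ℝ → ℝ) (hsm : ContDiff ℝ 2 h)
    (hk : ∀ a b : ℝ, ({t : ℝ | deriv h t = a * t + b}).encard ≤ (k : ℕ∞))
    (hsi : SuffInt (fun x y => h (y - x)) μ ν)
    (π : MeasureTheory.Measure (ℝ × ℝ))
    (hopt : IsOptimalMart (fun x y => h (y - x)) μ ν π) :
    ∀ κ : Kernel ℝ ℝ, IsMarkovKernel κ → μ.compProd κ = π →
      ∀ᵐ x ∂μ, ∃ s : Finset ℝ, s.card ≤ k ∧ κ x ((↑s : Set ℝ)ᶜ) = 0 := by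
  intro κ hκ hπ
  subst hπ
  have k1 := key μ ν hμ hν hatomless h hsm κ hopt 1 one_ne_zero
  have k2 := key μ ν hμ hν hatomless h hsm κ hopt (-1) (by norm_num)
  have hae : ∀ᵐ q ∂(μ ⊗ₘ (κ ×ₖ (κ ×ₖ κ))),
      ¬ (q.2.1 < q.2.2.1 ∧ q.2.2.1 < q.2.2.2 ∧ DD (deriv h) q ≠ 0) := by
    rw [ae_iff]
    refine measure_mono_null ?_ (measure_union_null k1 k2)
    intro q hq
    simp only [mem_ofPred_eq, not_not] at hq
    obtain ⟨a, b, c⟩ := hq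
    rcases lt_or_gt_of_ne c with h | h
    · right; exact ⟨a, b, by linarith⟩
    · left; exact ⟨a, b, by linarith⟩
  have hdc : Continuous (deriv h) := hsm.continuous_deriv (by norm_num)
  filter_upwards [Measure.ae_ae_of_ae_compProd hae] with x hx
  rw [Kernel.prod_apply, Kernel.prod_apply] at hx
  have hpos : ∀ y ∈ (κ x).support, ∀ V ∈ 𝓝 y, 0 < κ x V := fun y hy V hV =>
    (Measure.mem_support_iff_forall _).1 hy V hV
  -- all triples in the support are collinear
  have tri : ∀ y1 ∈ (κ x).support, ∀ y2 ∈ (κ x).support, ∀ y3 ∈ (κ x).support,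
      y1 < y2 → y2 < y3 → DD (deriv h) (x, y1, y2, y3) = 0 := by
    intro y1 h1 y2 h2 y3 h3 h12 h23
    by_contra hD
    have hO : IsOpen {y : ℝ × ℝ × ℝ | y.1 < y.2.1 ∧ y.2.1 < y.2.2 ∧ DD (deriv h) (x, y) ≠ 0} := by
      have c1 : Continuous (fun y : ℝ × ℝ × ℝ => DD (deriv h) (x, y)) := by
        unfold DD; fun_prop
      have o1 : IsOpen {q : ℝ × ℝ × ℝ | q.1 < q.2.1} := isOpen_lt (by fun_prop) (by fun_prop)
      have o2 : IsOpen {q : ℝ × ℝ × ℝ | q.2.1 < q.2.2} := isOpen_lt (by fun_prop) (by fun_prop)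
      exact o1.inter (o2.inter (isOpen_ne_fun c1 continuous_const))
    have hmem := hO.mem_nhds (x := (y1, y2, y3)) ⟨h12, h23, hD⟩
    rw [mem_nhds_prod_iff] at hmem
    obtain ⟨V1, hV1, V23, hV23, hsub⟩ := hmem
    rw [mem_nhds_prod_iff] at hV23
    obtain ⟨V2, hV2, V3, hV3, hsub2⟩ := hV23
    rw [ae_iff] at hx
    have hz : ((κ x).prod ((κ x).prod (κ x))) (V1 ×ˢ (V2 ×ˢ V3)) = 0 := by
      refine measure_mono_null ?_ hx
      rintro ⟨a, b, c⟩ ⟨ha, hbc⟩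
      have := hsub (⟨ha, hsub2 hbc⟩ : (a, b, c) ∈ V1 ×ˢ V23)
      simpa only [mem_ofPred_eq, not_not] using this
    rw [Measure.prod_prod, Measure.prod_prod] at hz
    have p1 := hpos y1 h1 V1 hV1
    have p2 := hpos y2 h2 V2 hV2
    have p3 := hpos y3 h3 V3 hV3
    exact (ENNReal.mul_pos p1.ne' (ENNReal.mul_pos p2.ne' p3.ne').ne').ne' hz
  have main : ∃ a b : ℝ, ∀ y ∈ (κ x).support, deriv h (y - x) = a * (y - x) + b := by
    by_cases hsub : (κ x).support.Subsingleton
    · rcases hsub.eq_empty_or_singleton with e | ⟨y, e⟩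
      · exact ⟨0, 0, by simp [e]⟩
      · exact ⟨0, deriv h (y - x), by simp [e]⟩
    · rw [not_subsingleton_iff] at hsub
      obtain ⟨u, hu, v, hv, huv⟩ := hsub.exists_lt
      have hne : v - u ≠ 0 := by linarith
      refine ⟨(deriv h (v - x) - deriv h (u - x)) / (v - u),
        deriv h (u - x) - (deriv h (v - x) - deriv h (u - x)) / (v - u) * (u - x), ?_⟩
      intro y hy
      have goal : (v - u) * deriv h (y - x) =
          (deriv h (v - x) - deriv h (u - x)) * (y - u) + (v - u) * deriv h (u - x) := by
        rcases lt_trichotomy y u with hl | rfl | hl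
        · have := tri y hy u hu v hv hl huv
          simp only [DD] at this
          linarith
        · ring
        · rcases lt_trichotomy y v with hl2 | rfl | hl2
          · have := tri u hu y hy v hv hl hl2
            simp only [DD] at this
            linarith
          · ring
          · have := tri u hu v hv y hy huv hl2
            simp only [DD] at this
            linarith
      have : deriv h (y - x) = ((deriv h (v - x) - deriv h (u - x)) * (y - u)
          + (v - u) * deriv h (u - x)) / (v - u) := by
        rw [← goal]; field_simp
      rw [this]; field_simp; ring
  obtain ⟨a, b, hab⟩ := main
  have hcard : (κ x).support.encard ≤ k := by
    refine le_trans ?_ (hk a b)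
    rw [← (sub_left_injective (b := x)).encard_image]
    apply encard_le_encard
    rintro _ ⟨y, hy, rfl⟩
    exact hab y hy
  have hfin : (κ x).support.Finite := finite_of_encard_le_coe hcard
  refine ⟨hfin.toFinset, ?_, ?_⟩
  · rw [hfin.encard_eq_coe_toFinset_card] at hcard
    exact_mod_cast hcard
  · rw [hfin.coe_toFinset]
    exact Measure.measure_compl_support
end
end

section
/- Let μ, ν be probability measures on ℝ, μ atomless. Let h : ℝ → ℝ be twice continuously differentiable such that for every b ∈ ℝ the equation h'(t) = b has at most k solutions, and let c(x,y) = h(y−x) satisfy the sufficient integrability condition with respect to μ and ν. Let π ∈ Π(μ,ν) satisfy ∫ c dπ < ∞ and ∫ c dπ ≤ ∫ c dπ' for every π' ∈ Π(μ,ν). Then for μ-almost every x ∈ ℝ, the support of the conditional measure π_x has at most k elements. -/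
open MeasureTheory Set Filter Topology

noncomputable section

theorem aux_bounds (m : Measure (ℝ × ℝ)) [IsFiniteMeasure m] (f : ℝ × ℝ → ℝ)
    (hf : Continuous f) (v δ : ℝ) (hb : ∀ᵐ p ∂m, |f p - v| ≤ δ) :
    Integrable f m ∧ (v - δ) * m.real univ ≤ ∫ p, f p ∂m ∧
      ∫ p, f p ∂m ≤ (v + δ) * m.real univ := by
  have hi : Integrable f m := by
    refine Integrable.of_bound hf.aestronglyMeasurable (|v| + δ) ?_
    filter_upwards [hb] with p hp
    rw [Real.norm_eq_abs]
    have := abs_add_le (f p - v) v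
    simp only [sub_add_cancel] at this
    linarith
  refine ⟨hi, ?_, ?_⟩
  · have : ∫ p, (v - δ) ∂m ≤ ∫ p, f p ∂m := by
      refine integral_mono_ae (integrable_const _) hi ?_
      filter_upwards [hb] with p hp
      have := (abs_le.1 hp).1
      linarith
    simpa [mul_comm] using this
  · have : ∫ p, f p ∂m ≤ ∫ p, (v + δ) ∂m := by
      refine integral_mono_ae hi (integrable_const _) ?_
      filter_upwards [hb] with p hp
      have := (abs_le.1 hp).2
      linarith
    simpa [mul_comm] using this

theorem aux_swap (μ ν : Measure ℝ) [IsProbabilityMeasure μ]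
    (f : ℝ × ℝ → ℝ) (hf : Continuous f) (π : Measure (ℝ × ℝ))
    (hπ : IsCoupling μ ν π) (hfin : Integrable f π)
    (hopt : ∀ π' : Measure (ℝ × ℝ), IsCoupling μ ν π' → Integrable f π' →
      (∫ p, f p ∂π) ≤ ∫ p, f p ∂π')
    (p q : ℝ × ℝ) (hp : p ∈ π.support) (hq : q ∈ π.support) :
    f p + f q ≤ f (p.1, q.2) + f (q.1, p.2) := by
  by_contra! hlt
  obtain ⟨δ, hδ, hgap⟩ : ∃ δ : ℝ, 0 < δ ∧
      f (p.1, q.2) + f (q.1, p.2) + 4 * δ < f p + f q :=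
    ⟨(f p + f q - (f (p.1, q.2) + f (q.1, p.2))) / 8, by linarith, by linarith⟩
  have hcont : ∀ z : ℝ × ℝ, ∃ r > 0, ∀ w : ℝ × ℝ, |w.1 - z.1| < r → |w.2 - z.2| < r →
      |f w - f z| ≤ δ := by
    intro z
    obtain ⟨r, hr, H⟩ := Metric.continuous_iff.1 hf z δ hδ
    refine ⟨r, hr, fun w h1 h2 => ?_⟩
    have := H w (by rw [Prod.dist_eq]; exact max_lt h1 h2)
    exact this.le
  obtain ⟨r1, hr1, H1⟩ := hcont p
  obtain ⟨r2, hr2, H2⟩ := hcont q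
  obtain ⟨r3, hr3, H3⟩ := hcont (p.1, q.2)
  obtain ⟨r4, hr4, H4⟩ := hcont (q.1, p.2)
  obtain ⟨r, hr, h1, h2, h3, h4⟩ : ∃ r > 0, r ≤ r1 ∧ r ≤ r2 ∧ r ≤ r3 ∧ r ≤ r4 :=
    ⟨min (min r1 r2) (min r3 r4), by positivity, by simp, by simp, by simp, by simp⟩
  have hprob : IsProbabilityMeasure π := by
    refine ⟨?_⟩
    have := congrArg (fun m => m univ) hπ.1
    simpa [Measure.map_apply measurable_fst MeasurableSet.univ] using this
  set m1 := π.restrict (Metric.ball p r) with hm1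
  set m2 := π.restrict (Metric.ball q r) with hm2
  have hm1le : m1 ≤ π := Measure.restrict_le_self
  have hm2le : m2 ≤ π := Measure.restrict_le_self
  have hball : ∀ z : ℝ × ℝ, ∀ᵐ w ∂(π.restrict (Metric.ball z r)),
      |w.1 - z.1| < r ∧ |w.2 - z.2| < r := by
    intro z
    filter_upwards [ae_restrict_mem Metric.isOpen_ball.measurableSet] with w hw
    rw [Metric.mem_ball, Prod.dist_eq] at hw
    exact ⟨(le_max_left _ _).trans_lt hw, (le_max_right _ _).trans_lt hw⟩
  have hb1 := hball p
  have hb2 := hball q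
  rw [← hm1] at hb1
  rw [← hm2] at hb2
  have hpos1 : 0 < m1 univ := by
    rw [hm1, Measure.restrict_apply_univ]
    exact (Measure.mem_support_iff_forall p).1 hp _ (Metric.ball_mem_nhds _ hr)
  have hpos2 : 0 < m2 univ := by
    rw [hm2, Measure.restrict_apply_univ]
    exact (Measure.mem_support_iff_forall q).1 hq _ (Metric.ball_mem_nhds _ hr)
  have hle1 : m1 univ ≤ 1 := (hm1le univ).trans prob_le_one
  have hle2 : m2 univ ≤ 1 := (hm2le univ).trans prob_le_one
  set σ1 := (m1.map Prod.fst).prod (m2.map Prod.snd) with hσ1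
  set σ2 := (m2.map Prod.fst).prod (m1.map Prod.snd) with hσ2
  have hM : ∀ m : Measure (ℝ × ℝ), (m.map Prod.fst) univ = m univ ∧
      (m.map Prod.snd) univ = m univ := fun m =>
    ⟨by rw [Measure.map_apply measurable_fst MeasurableSet.univ, preimage_univ],
     by rw [Measure.map_apply measurable_snd MeasurableSet.univ, preimage_univ]⟩
  have hprodb : ∀ (m m' : Measure (ℝ × ℝ)) [IsFiniteMeasure m] [IsFiniteMeasure m'] (z z' : ℝ × ℝ),
      (∀ᵐ w ∂m, |w.1 - z.1| < r ∧ |w.2 - z.2| < r) →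
      (∀ᵐ w ∂m', |w.1 - z'.1| < r ∧ |w.2 - z'.2| < r) →
      ∀ᵐ w ∂((m.map Prod.fst).prod (m'.map Prod.snd)), |w.1 - z.1| < r ∧ |w.2 - z'.2| < r := by
    intro m m' _ _ z z' h h'
    have e1 : ∀ᵐ x ∂(m.map Prod.fst), |x - z.1| < r := by
      rw [ae_map_iff measurable_fst.aemeasurable
        (measurableSet_lt (by fun_prop) measurable_const)]
      exact h.mono fun w hw => hw.1
    have e2 : ∀ᵐ x ∂(m'.map Prod.snd), |x - z'.2| < r := by
      rw [ae_map_iff measurable_snd.aemeasurable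
        (measurableSet_lt (by fun_prop) measurable_const)]
      exact h'.mono fun w hw => hw.2
    filter_upwards [Measure.quasiMeasurePreserving_fst.ae e1,
      Measure.quasiMeasurePreserving_snd.ae e2] with w a b using ⟨a, b⟩
  have hc1 := hprodb m1 m2 p q hb1 hb2
  have hc2 := hprodb m2 m1 q p hb2 hb1
  rw [← hσ1] at hc1
  rw [← hσ2] at hc2
  obtain ⟨i1, l1, -⟩ := aux_bounds m1 f hf (f p) δ
    (hb1.mono fun w hw => H1 w (hw.1.trans_le h1) (hw.2.trans_le h1))
  obtain ⟨i2, l2, -⟩ := aux_bounds m2 f hf (f q) δ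
    (hb2.mono fun w hw => H2 w (hw.1.trans_le h2) (hw.2.trans_le h2))
  obtain ⟨i3, -, l3⟩ := aux_bounds σ1 f hf (f (p.1, q.2)) δ
    (hc1.mono fun w hw => H3 w (hw.1.trans_le h3) (hw.2.trans_le h3))
  obtain ⟨i4, -, l4⟩ := aux_bounds σ2 f hf (f (q.1, p.2)) δ
    (hc2.mono fun w hw => H4 w (hw.1.trans_le h4) (hw.2.trans_le h4))
  have hs1 : σ1 univ = m1 univ * m2 univ := by
    rw [hσ1, ← univ_prod_univ, Measure.prod_prod, (hM m1).1, (hM m2).2]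
    simp
  have hs2 : σ2 univ = m2 univ * m1 univ := by
    rw [hσ2, ← univ_prod_univ, Measure.prod_prod, (hM m2).1, (hM m1).2]
    simp
  have hr1' : σ1.real univ = m1.real univ * m2.real univ := by
    simp [Measure.real, hs1]
  have hr2' : σ2.real univ = m1.real univ * m2.real univ := by
    simp [Measure.real, hs2, mul_comm]
  have ha : 0 < m1.real univ := ENNReal.toReal_pos hpos1.ne' (measure_ne_top _ _)
  have hb : 0 < m2.real univ := ENNReal.toReal_pos hpos2.ne' (measure_ne_top _ _)
  set ρ : Measure (ℝ × ℝ) := (2⁻¹ : ENNReal) • ((m2 univ) • m1 + (m1 univ) • m2) with hρ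
  set σ : Measure (ℝ × ℝ) := (2⁻¹ : ENNReal) • (σ1 + σ2) with hσ
  have hρle : ρ ≤ π := by
    have : (m2 univ) • m1 + (m1 univ) • m2 ≤ (2 : ENNReal) • π := by
      have e1 : (m2 univ) • m1 ≤ π := by
        calc (m2 univ) • m1 ≤ (1 : ENNReal) • m1 := by gcongr
          _ ≤ π := by rwa [one_smul]
      have e2 : (m1 univ) • m2 ≤ π := by
        calc (m1 univ) • m2 ≤ (1 : ENNReal) • m2 := by gcongr
          _ ≤ π := by rwa [one_smul]
      rw [two_smul]
      exact add_le_add e1 e2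
    calc ρ ≤ (2⁻¹ : ENNReal) • ((2 : ENNReal) • π) := by rw [hρ]; gcongr
      _ = π := by
        rw [smul_smul, ENNReal.inv_mul_cancel (by norm_num) (by norm_num), one_smul]
  have hρfin : IsFiniteMeasure ρ := isFiniteMeasure_of_le π hρle
  have hdec : π - ρ + ρ = π := Measure.sub_add_cancel_of_le hρle
  have hfst : σ.map Prod.fst = ρ.map Prod.fst := by
    rw [hσ, hρ, Measure.map_smul, Measure.map_smul, Measure.map_add _ _ measurable_fst,
      Measure.map_add _ _ measurable_fst, Measure.map_smul, Measure.map_smul, hσ1, hσ2,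
      Measure.map_fst_prod, Measure.map_fst_prod, (hM m1).2, (hM m2).2]
  have hsnd : σ.map Prod.snd = ρ.map Prod.snd := by
    rw [hσ, hρ, Measure.map_smul, Measure.map_smul, Measure.map_add _ _ measurable_snd,
      Measure.map_add _ _ measurable_snd, Measure.map_smul, Measure.map_smul, hσ1, hσ2,
      Measure.map_snd_prod, Measure.map_snd_prod, (hM m1).1, (hM m2).1, add_comm]
  have hcoup : IsCoupling μ ν (π - ρ + σ) := by
    constructor
    · rw [Measure.map_add _ _ measurable_fst, hfst, ← Measure.map_add _ _ measurable_fst, hdec]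
      exact hπ.1
    · rw [Measure.map_add _ _ measurable_snd, hsnd, ← Measure.map_add _ _ measurable_snd, hdec]
      exact hπ.2
  have iρ : Integrable f ρ := hfin.mono_measure hρle
  have iσ : Integrable f σ := (i3.add_measure i4).smul_measure (by norm_num)
  have iτ : Integrable f (π - ρ) := hfin.mono_measure Measure.sub_le
  have key := hopt _ hcoup (iτ.add_measure iσ)
  rw [integral_add_measure iτ iσ] at key
  nth_rewrite 1 [← hdec] at key
  rw [integral_add_measure iτ iρ] at key
  have e1 : ∫ w, f w ∂ρ = 2⁻¹ * (m2.real univ * ∫ w, f w ∂m1 + m1.real univ * ∫ w, f w ∂m2) := by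
    rw [hρ, integral_smul_measure, integral_add_measure (i1.smul_measure (measure_ne_top _ _))
      (i2.smul_measure (measure_ne_top _ _)), integral_smul_measure, integral_smul_measure]
    simp [Measure.real]
  have e2 : ∫ w, f w ∂σ = 2⁻¹ * (∫ w, f w ∂σ1 + ∫ w, f w ∂σ2) := by
    rw [hσ, integral_smul_measure, integral_add_measure i3 i4]
    simp
  rw [hr1'] at l3
  rw [hr2'] at l4
  have l1' := mul_le_mul_of_nonneg_left l1 hb.le
  have l2' := mul_le_mul_of_nonneg_left l2 ha.le
  have hab := mul_pos ha hb
  have := mul_lt_mul_of_pos_right hgap hab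
  rw [e1, e2] at key
  nlinarith

theorem aux_countable (k : ℕ) (h : ℝ → ℝ) (hsm : ContDiff ℝ 2 h)
    (hk : ∀ b : ℝ, ({t : ℝ | deriv h t = b}).encard ≤ (k : ℕ∞))
    (Γ : Set (ℝ × ℝ))
    (hΓ : ∀ p ∈ Γ, ∀ q ∈ Γ, h (p.2 - p.1) + h (q.2 - q.1) ≤ h (q.2 - p.1) + h (p.2 - q.1)) :
    {x : ℝ | (k : ℕ∞) < {y | (x, y) ∈ Γ}.encard}.Countable := by
  set A := {x : ℝ | (k : ℕ∞) < {y | (x, y) ∈ Γ}.encard} with hA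
  have hsel : ∀ x : A, ∃ g : Fin (k + 1) → ℝ, Function.Injective g ∧ ∀ i, (x.1, g i) ∈ Γ := by
    rintro ⟨x, hx⟩
    have hx' : ((k + 1 : ℕ) : ℕ∞) ≤ {y | (x, y) ∈ Γ}.encard := by
      push_cast
      exact Order.add_one_le_of_lt hx
    obtain ⟨t, ht, hc⟩ := Set.exists_subset_encard_eq hx'
    have hfin : t.Finite := Set.finite_of_encard_eq_coe hc
    have hc' : hfin.toFinset.card = k + 1 := by
      rw [hfin.encard_eq_coe_toFinset_card] at hc
      exact_mod_cast hc
    refine ⟨fun i => hfin.toFinset.orderEmbOfFin hc' i,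
      (hfin.toFinset.orderEmbOfFin hc').injective, fun i => ?_⟩
    have := Finset.orderEmbOfFin_mem hfin.toFinset hc' i
    exact ht (hfin.mem_toFinset.1 this)
  choose g hinj hg using hsel
  have hdiff : Differentiable ℝ h := hsm.differentiable (by norm_num)
  have hdc : Continuous (deriv h) := hsm.continuous_deriv (by norm_num)
  set S : Set (ℝ × (Fin (k + 1) → ℝ)) := range fun x : A => (x.1, g x) with hS
  have hdisc : DiscreteTopology S := by
    rw [discreteTopology_iff_isOpen_singleton]
    rintro ⟨_, ⟨a, rfl⟩⟩
    -- two indices with different derivative values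
    obtain ⟨i, j, hij⟩ : ∃ i j, deriv h (g a i - a.1) < deriv h (g a j - a.1) := by
      by_contra! hcon
      have hall : ∀ i, deriv h (g a i - a.1) = deriv h (g a 0 - a.1) :=
        fun i => le_antisymm (hcon _ _) (hcon _ _)
      have hsub : range (fun i => g a i - a.1) ⊆ {t | deriv h t = deriv h (g a 0 - a.1)} := by
        rintro _ ⟨i, rfl⟩
        exact hall i
      have h1 := (Set.encard_le_encard hsub).trans (hk _)
      have h2 : Function.Injective (fun i => g a i - a.1) := fun i j e =>
        hinj a (by simpa using e)
      rw [← image_univ, h2.encard_image, Set.encard_univ] at h1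
      simp only [ENat.card_eq_coe_fintype_card, Fintype.card_fin] at h1
      have : k + 1 ≤ k := by exact_mod_cast h1
      omega
    obtain ⟨m, hm1, hm2⟩ := exists_between hij
    obtain ⟨r1, hr1, H1⟩ := Metric.eventually_nhds_iff.1
      (hdc.continuousAt.eventually_lt continuousAt_const hm1)
    obtain ⟨r2, hr2, H2⟩ := Metric.eventually_nhds_iff.1
      (continuousAt_const.eventually_lt hdc.continuousAt hm2)
    rw [Metric.isOpen_singleton_iff]
    refine ⟨min r1 r2 / 2, by positivity, ?_⟩
    rintro ⟨_, ⟨a', rfl⟩⟩ hd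
    rw [Subtype.dist_eq, Prod.dist_eq] at hd
    have hda : |a'.1 - a.1| < min r1 r2 / 2 := (le_max_left _ _).trans_lt hd
    have hdg : ∀ l, |g a' l - g a l| < min r1 r2 / 2 := fun l =>
      (dist_le_pi_dist (g a') (g a) l).trans_lt ((le_max_right _ _).trans_lt hd)
    have hmin1 := min_le_left r1 r2
    have hmin2 := min_le_right r1 r2
    -- mean value statement
    have hmv : ∀ y u v : ℝ, u < v → ∃ ξ, y - v < ξ ∧ ξ < y - u ∧
        h (y - u) - h (y - v) = deriv h ξ * (v - u) := by
      intro y u v huv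
      obtain ⟨ξ, hξ, e⟩ := exists_deriv_eq_slope h (show y - v < y - u by linarith)
        hdiff.continuous.continuousOn hdiff.differentiableOn
      refine ⟨ξ, hξ.1, hξ.2, ?_⟩
      rw [e]
      have : v - u ≠ 0 := by linarith [huv] |> fun (h : 0 < v - u) => h.ne'
      have e2 : y - u - (y - v) = v - u := by ring
      rw [e2]
      field_simp
    have hai := abs_lt.1 (hdg i)
    have haj := abs_lt.1 (hdg j)
    have haa := abs_lt.1 hda
    rcases lt_trichotomy a.1 a'.1 with hlt | heq | hgt
    · exfalso
      obtain ⟨ξ, x1, x2, e⟩ := hmv (g a j) _ _ hlt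
      obtain ⟨η, y1, y2, e'⟩ := hmv (g a' i) _ _ hlt
      have hξ : m < deriv h ξ := H2 (by rw [Real.dist_eq, abs_lt]; constructor <;> linarith)
      have hη : deriv h η < m := H1 (by rw [Real.dist_eq, abs_lt]; constructor <;> linarith)
      have := hΓ _ (hg a j) _ (hg a' i)
      simp only at this
      nlinarith
    · have : a' = a := Subtype.ext heq.symm
      subst this
      rfl
    · exfalso
      obtain ⟨ξ, x1, x2, e⟩ := hmv (g a i) _ _ hgt
      obtain ⟨η, y1, y2, e'⟩ := hmv (g a' j) _ _ hgt
      have hξ : deriv h ξ < m := H1 (by rw [Real.dist_eq, abs_lt]; constructor <;> linarith)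
      have hη : m < deriv h η := H2 (by rw [Real.dist_eq, abs_lt]; constructor <;> linarith)
      have := hΓ _ (hg a i) _ (hg a' j)
      simp only at this
      nlinarith
  have hSc : Countable S := countable_of_Lindelof_of_discrete
  have hinjS : Function.Injective (fun x : A => (⟨(x.1, g x), ⟨x, rfl⟩⟩ : S)) := by
    intro x y e
    have := congrArg (fun s : S => s.1.1) e
    exact Subtype.ext this
  exact Set.countable_coe_iff.1 hinjS.countable

open ProbabilityTheory in
/-- classical transport version: for costs `h(y-x)` where `h'` takes
every value at most `k` times, the conditional measures of an optimal transport
plan are supported on at most `k` points (for continuous `μ`). -/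
theorem optimal_classical_conditional_support_le
    (k : ℕ) (μ ν : MeasureTheory.Measure ℝ)
    [MeasureTheory.IsProbabilityMeasure μ] [MeasureTheory.IsProbabilityMeasure ν]
    (hatomless : ∀ x : ℝ, μ {x} = 0)
    (h : ℝ → ℝ) (hsm : ContDiff ℝ 2 h)
    (hk : ∀ b : ℝ, ({t : ℝ | deriv h t = b}).encard ≤ (k : ℕ∞))
    (hsi : SuffInt (fun x y => h (y - x)) μ ν)
    (π : MeasureTheory.Measure (ℝ × ℝ))
    (hπ : IsCoupling μ ν π)
    (hfin : MeasureTheory.Integrable (fun p : ℝ × ℝ => h (p.2 - p.1)) π)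
    (hopt : ∀ π' : MeasureTheory.Measure (ℝ × ℝ), IsCoupling μ ν π' →
      MeasureTheory.Integrable (fun p : ℝ × ℝ => h (p.2 - p.1)) π' →
      (∫ p : ℝ × ℝ, h (p.2 - p.1) ∂π) ≤ ∫ p : ℝ × ℝ, h (p.2 - p.1) ∂π') :
    ∀ κ : Kernel ℝ ℝ, IsMarkovKernel κ → μ.compProd κ = π →
      ∀ᵐ x ∂μ, ∃ s : Finset ℝ, s.card ≤ k ∧ κ x ((↑s : Set ℝ)ᶜ) = 0 := by
  intro κ hκ hcomp
  have hc : Continuous h := hsm.continuous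
  have hsw := aux_swap μ ν (fun p => h (p.2 - p.1)) (by fun_prop) π hπ hfin hopt
  have hcount := aux_countable k h hsm hk π.support (fun p hp q hq => hsw p q hp hq)
  have hnull : μ {x : ℝ | (k : ℕ∞) < {y | (x, y) ∈ π.support}.encard} = 0 := by
    have : NullSingletonClass μ := ⟨hatomless⟩
    exact hcount.measure_zero μ
  have hae : ∀ᵐ p ∂(μ.compProd κ), p ∈ π.support := by
    rw [hcomp]
    exact Measure.support_mem_ae
  have hn : ∀ᵐ x ∂μ, ¬ ((k : ℕ∞) < {y | (x, y) ∈ π.support}.encard) := by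
    rw [ae_iff]
    simpa using hnull
  filter_upwards [Measure.ae_ae_of_ae_compProd hae, hn] with x hx hxn
  have hle := not_lt.1 hxn
  have hf : {y | (x, y) ∈ π.support}.Finite := Set.finite_of_encard_le_coe hle
  refine ⟨hf.toFinset, ?_, ?_⟩
  · rw [hf.encard_eq_coe_toFinset_card] at hle
    exact_mod_cast hle
  · rw [hf.coe_toFinset]
    exact hx
end
end
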